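/- Let n+1 ≤ k ≤ 2n², let u_1,…,u_k ∈ S^{n−1} and c_1,…,c_k > 0 satisfy Σ_{i=1}^k c_i u_i⊗u_i = Id_n and Σ_{i=1}^k c_i u_i = 0, and suppose ℓ(C) ≥ (1−ε)ℓ(Δ_n) holds for C = conv{u_1,…,u_k} and some ε ∈ (0, n^{−60n}). Then, with η = n^{15n}·ε^{1/4} ∈ (0,1), there exist unit vectors w_1,…,w_{n+1} ∈ S^{n−1} forming the vertices of a regular simplex (pairwise inner products −1/n) and indices {i_1,…,i_{n+1}} ⊆ {1,…,k} such that ∠(u_{i_j}, w_j) ≤ η for j = 1,…,n+1. -/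

import Mathlib

open MeasureTheory Metric Set
open scoped RealInnerProductSpace ENNReal

noncomputable section

/-- The standard Gaussian measure `γ_n` on `ℝ^n`. -/
def gaussianM (n : ℕ) : Measure (EuclideanSpace ℝ (Fin n)) :=
  volume.withDensity fun x =>
    ENNReal.ofReal ((2 * Real.pi) ^ (-(n : ℝ) / 2) * Real.exp (-‖x‖ ^ 2 / 2))

/-- The ℓ-norm of a convex body: `ℓ(K) = ∫ ‖x‖_K dγ_n(x)`, where `‖·‖_K` is the gauge of `K`. -/
def ellNorm (n : ℕ) (K : Set (EuclideanSpace ℝ (Fin n))) : ℝ :=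
  ∫ x, gauge K x ∂(gaussianM n)

/-- The support function `h_K`. -/
def suppFn {n : ℕ} (K : Set (EuclideanSpace ℝ (Fin n))) (u : EuclideanSpace ℝ (Fin n)) : ℝ :=
  sSup ((fun y => ⟪u, y⟫) '' K)

/-- The mean width `W(K) = (1/(n κ_n)) ∫_{S^{n-1}} (h_K(u) + h_K(-u)) du`, the integration over
the unit sphere being with respect to the (n-1)-dimensional Hausdorff measure. -/
def meanWidth (n : ℕ) (K : Set (EuclideanSpace ℝ (Fin n))) : ℝ :=
  (1 / (n * (volume (closedBall (0 : EuclideanSpace ℝ (Fin n)) 1)).toReal)) *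
    ∫ u in sphere (0 : EuclideanSpace ℝ (Fin n)) 1,
      (suppFn K u + suppFn K (-u)) ∂(μH[(n : ℝ) - 1])

/-- The polar set `K° = {x : ⟨x,y⟩ ≤ 1 for all y ∈ K}`. -/
def polarSet {n : ℕ} (K : Set (EuclideanSpace ℝ (Fin n))) : Set (EuclideanSpace ℝ (Fin n)) :=
  {x | ∀ y ∈ K, ⟪x, y⟫ ≤ 1}

/-- `w` lists the vertices of a regular simplex inscribed in the unit ball: `n+1` unit vectors
with pairwise inner products `-1/n`. -/
def IsRegVerts {n : ℕ} (w : Fin (n + 1) → EuclideanSpace ℝ (Fin n)) : Prop :=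
  (∀ i, ‖w i‖ = 1) ∧ ∀ i j, i ≠ j → ⟪w i, w j⟫ = -1 / n

/-- An ellipsoid: an image of the closed Euclidean unit ball under an invertible affine map. -/
def IsEllipsoid {n : ℕ} (D : Set (EuclideanSpace ℝ (Fin n))) : Prop :=
  ∃ f : EuclideanSpace ℝ (Fin n) ≃ᵃ[ℝ] EuclideanSpace ℝ (Fin n),
    D = f '' closedBall 0 1

/-- `D` is the Löwner ellipsoid (minimal volume ellipsoid containing) of `K`. -/
def IsLoewnerEllipsoid {n : ℕ} (D K : Set (EuclideanSpace ℝ (Fin n))) : Prop :=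
  IsEllipsoid D ∧ K ⊆ D ∧ ∀ D', IsEllipsoid D' → K ⊆ D' → volume D ≤ volume D'

/-- `D` is the John ellipsoid (maximal volume ellipsoid contained in) of `K`. -/
def IsJohnEllipsoid {n : ℕ} (D K : Set (EuclideanSpace ℝ (Fin n))) : Prop :=
  IsEllipsoid D ∧ D ⊆ K ∧ ∀ D', IsEllipsoid D' → D' ⊆ K → volume D' ≤ volume D

/-- Gaussian tail. -/
def gtail (x : ℝ) : ℝ := ∫ t in Ioi x, Real.exp (-t ^ 2 / 2)

lemma gexp_integrable : Integrable (fun t : ℝ => Real.exp (-t ^ 2 / 2)) := by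
  have := integrable_exp_neg_mul_sq (b := 1 / 2) (by norm_num)
  refine this.congr (Filter.Eventually.of_forall fun t => ?_)
  simp only []
  congr 1; ring

lemma gexp_integral : ∫ t : ℝ, Real.exp (-t ^ 2 / 2) = √(2 * Real.pi) := by
  have := integral_gaussian (1 / 2)
  rw [show 2 * Real.pi = Real.pi / (1 / 2) by ring, ← this]
  congr 1; ext t; congr 1; ring

lemma gtail_hasStrictDerivAt (x : ℝ) : HasStrictDerivAt gtail (-Real.exp (-x ^ 2 / 2)) x := by
  have h : gtail = fun y => (∫ t : ℝ, Real.exp (-t ^ 2 / 2)) -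
      ((∫ t in Iic 0, Real.exp (-t ^ 2 / 2)) + ∫ t in (0:ℝ)..y, Real.exp (-t ^ 2 / 2)) := by
    ext y
    have h1 := intervalIntegral.integral_Iic_add_Ioi (f := fun t : ℝ => Real.exp (-t ^ 2 / 2)) (b := y)
      gexp_integrable.integrableOn gexp_integrable.integrableOn
    have h2 := intervalIntegral.integral_Iic_sub_Iic (f := fun t : ℝ => Real.exp (-t ^ 2 / 2)) (a := 0) (b := y)
      gexp_integrable.integrableOn gexp_integrable.integrableOn
    unfold gtail
    linarith
  rw [h]
  have hc : Continuous (fun t : ℝ => Real.exp (-t ^ 2 / 2)) := by fun_prop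
  have := hc.integral_hasStrictDerivAt 0 x
  have := (this.const_add (∫ t in Iic 0, Real.exp (-t ^ 2 / 2))).const_sub (∫ t : ℝ, Real.exp (-t ^ 2 / 2))
  exact this

lemma gtail_continuous : Continuous gtail :=
  continuous_iff_continuousAt.2 fun x => (gtail_hasStrictDerivAt x).hasDerivAt.continuousAt

lemma gtail_strictAnti : StrictAnti gtail :=
  strictAnti_of_deriv_neg fun x => by
    rw [(gtail_hasStrictDerivAt x).hasDerivAt.deriv]
    simp [Real.exp_pos]

lemma gtail_add_neg (x : ℝ) : gtail x + gtail (-x) = √(2 * Real.pi) := by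
  have h1 := intervalIntegral.integral_Iic_add_Ioi (f := fun t : ℝ => Real.exp (-t ^ 2 / 2)) (b := x)
      gexp_integrable.integrableOn gexp_integrable.integrableOn
  have h2 := integral_comp_neg_Iic x (fun t : ℝ => Real.exp (-t ^ 2 / 2))
  simp only [neg_sq] at h2
  rw [gexp_integral] at h1
  unfold gtail
  linarith

lemma gtail_nonneg (x : ℝ) : 0 ≤ gtail x := integral_nonneg fun _ => (Real.exp_pos _).le

lemma gtail_pos (x : ℝ) : 0 < gtail x :=
  (gtail_nonneg (x + 1)).trans_lt (gtail_strictAnti (by linarith))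

lemma gtail_lt (x : ℝ) : gtail x < √(2 * Real.pi) := by
  have := gtail_add_neg x
  have := gtail_pos (-x)
  linarith

lemma gtail_zero : gtail 0 = √(2 * Real.pi) / 2 := by
  have := gtail_add_neg 0
  simp at this ⊢
  linarith

lemma gtail_tendsto : Filter.Tendsto gtail Filter.atTop (nhds 0) := by
  have h : Filter.Tendsto (fun y : ℝ => √(2 * Real.pi) - ∫ t in Iic y, Real.exp (-t ^ 2 / 2)) Filter.atTop
      (nhds (√(2 * Real.pi) - √(2 * Real.pi))) := by
    refine Filter.Tendsto.const_sub _ ?_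
    rw [← gexp_integral]
    have := (aecover_Iic (μ := (volume : Measure ℝ)) (Filter.tendsto_id (α := ℝ) (x := Filter.atTop))).integral_tendsto_of_countably_generated
      gexp_integrable
    simpa using this
  rw [sub_self] at h
  refine h.congr fun y => ?_
  have h1 := intervalIntegral.integral_Iic_add_Ioi (f := fun t : ℝ => Real.exp (-t ^ 2 / 2)) (b := y)
      gexp_integrable.integrableOn gexp_integrable.integrableOn
  rw [gexp_integral] at h1
  unfold gtail
  linarith

/-- inverse Mills ratio is antitone. -/
lemma gtail_mills {x y : ℝ} (h : x ≤ y) :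
    gtail y * Real.exp (y ^ 2 / 2) ≤ gtail x * Real.exp (x ^ 2 / 2) := by
  have key : ∀ x : ℝ, gtail x * Real.exp (x ^ 2 / 2) = ∫ u in Ioi (0:ℝ), Real.exp (-(x * u) - u ^ 2 / 2) ∧
      IntegrableOn (fun u : ℝ => Real.exp (-(x * u) - u ^ 2 / 2)) (Ioi 0) := by
    intro x
    have hh : ∀ u : ℝ, Real.exp (-(x * u) - u ^ 2 / 2) = Real.exp (-(x + u) ^ 2 / 2) * Real.exp (x ^ 2 / 2) := by
      intro u; rw [← Real.exp_add]; congr 1; ring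
    simp_rw [hh]
    constructor
    · rw [integral_mul_const]
      congr 1
      unfold gtail
      have := (measurePreserving_add_left (volume : Measure ℝ) x).setIntegral_preimage_emb
        (measurableEmbedding_addLeft x) (fun t : ℝ => Real.exp (-t ^ 2 / 2)) (Ioi x)
      rw [← this]; simp
    · exact ((gexp_integrable.comp_add_left x).mul_const _).integrableOn
  rw [(key x).1, (key y).1]
  refine setIntegral_mono_on (key y).2 (key x).2 measurableSet_Ioi fun u hu => ?_
  apply Real.exp_le_exp.2
  have : 0 < u := hu
  nlinarith

lemma exists_tau (q : ℝ) (h0 : 0 < q) (h1 : q < 1) : ∃ τ : ℝ → ℝ,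
    (∀ x, gtail (τ x) = q * gtail x) ∧ (∀ x, HasDerivAt τ (q * Real.exp ((τ x ^ 2 - x ^ 2) / 2)) x) ∧
    (∀ x, x < τ x) ∧ (∀ x, q * Real.exp ((τ x ^ 2 - x ^ 2) / 2) ≤ 1) ∧ StrictMono τ := by
  have hex : ∀ x, ∃ y, gtail y = q * gtail x := by
    intro x
    have hpos : 0 < q * gtail x := mul_pos h0 (gtail_pos x)
    obtain ⟨b, hb1, hb2⟩ := ((gtail_tendsto.eventually (gt_mem_nhds hpos)).and
      (Filter.eventually_ge_atTop x)).exists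
    have := intermediate_value_Icc' hb2 gtail_continuous.continuousOn
    obtain ⟨y, _, hy⟩ := this ⟨hb1.le, by nlinarith [gtail_pos x]⟩
    exact ⟨y, hy⟩
  choose τ hτ using hex
  have hlt : ∀ x, x < τ x := by
    intro x
    rw [← gtail_strictAnti.lt_iff_gt, hτ]
    nlinarith [gtail_pos x]
  refine ⟨τ, hτ, ?_, hlt, ?_, ?_⟩
  · intro x
    have hs := gtail_hasStrictDerivAt (τ x)
    have hne : -Real.exp (-(τ x) ^ 2 / 2) ≠ 0 := by simp [Real.exp_ne_zero]
    set g := hs.localInverse gtail _ (τ x) hne with hg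
    have hgd : HasDerivAt g (-Real.exp (-(τ x) ^ 2 / 2))⁻¹ (gtail (τ x)) :=
      (hs.to_localInverse hne).hasDerivAt
    have hr : ∀ᶠ y in nhds (gtail (τ x)), gtail (g y) = y :=
      (hs.hasStrictFDerivAt_equiv hne).eventually_right_inverse
    have hq : HasDerivAt (fun y => q * gtail y) (q * -Real.exp (-x ^ 2 / 2)) x :=
      (gtail_hasStrictDerivAt x).hasDerivAt.const_mul q
    rw [hτ] at hr hgd
    have hcomp := hgd.comp x hq
    have hev : τ =ᶠ[nhds x] g ∘ (fun y => q * gtail y) := by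
      filter_upwards [hq.continuousAt.eventually hr] with y hy
      apply gtail_strictAnti.injective
      rw [hτ]; exact hy.symm
    refine (hcomp.congr_of_eventuallyEq hev).congr_deriv ?_
    rw [show (τ x ^ 2 - x ^ 2) / 2 = -x ^ 2 / 2 - (-(τ x) ^ 2 / 2) by ring, Real.exp_sub]
    field_simp
  · intro x
    have := gtail_mills (hlt x).le
    rw [hτ] at this
    have e : Real.exp ((τ x ^ 2 - x ^ 2) / 2) = Real.exp (τ x ^ 2 / 2) / Real.exp (x ^ 2 / 2) := by
      rw [← Real.exp_sub]; congr 1; ring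
    rw [e, ← mul_div_assoc, div_le_one (Real.exp_pos _)]
    have := gtail_pos x
    by_contra hcon
    push Not at hcon
    nlinarith
  · intro x y hxy
    rw [← gtail_strictAnti.lt_iff_gt, hτ, hτ]
    exact mul_lt_mul_of_pos_left (gtail_strictAnti hxy) h0

lemma tau_pos_of (q : ℝ) (h1 : q ≤ 1 / 2) {x y : ℝ} (h : gtail y = q * gtail x) : 0 < y := by
  rw [← gtail_strictAnti.lt_iff_gt, h, gtail_zero]
  nlinarith [gtail_lt x, gtail_pos x]

lemma tau_gt_of {s x y : ℝ} (h : gtail y = gtail (-s) / √(2 * Real.pi) * gtail x) : -s < y := by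
  rw [← gtail_strictAnti.lt_iff_gt, h]
  have : (0:ℝ) < √(2 * Real.pi) := by positivity
  rw [div_mul_eq_mul_div, div_lt_iff₀ this]
  exact mul_lt_mul_of_pos_left (gtail_lt x) (gtail_pos _)

/-- difference of derivatives lower bound -/
lemma tau_deriv_diff {q : ℝ} {τ : ℝ → ℝ} (h0 : 0 < q) (hm : StrictMono τ) (hp : ∀ x, 0 < τ x)
    {x y A B : ℝ} (hxA : x ≤ -A) (hAB : B < A) (hB : 0 ≤ B) (hyB : -B ≤ y) (hy : y ≤ 0) (hA1 : A ≤ 1) :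
    q * (A ^ 2 - B ^ 2) / 4 ≤
    q * Real.exp ((τ y ^ 2 - y ^ 2) / 2) - q * Real.exp ((τ x ^ 2 - x ^ 2) / 2) := by
  have hτ : τ x ^ 2 ≤ τ y ^ 2 := by
    have := hm.monotone (show x ≤ y by linarith)
    have := hp x
    nlinarith
  have e1 : ∀ a b : ℝ, Real.exp ((a - b) / 2) = Real.exp (a / 2) * Real.exp (-(b/2)) := by
    intro a b; rw [← Real.exp_add]; congr 1; ring
  have h1 : Real.exp (τ x ^ 2 / 2) ≤ Real.exp (τ y ^ 2 / 2) := Real.exp_le_exp.2 (by linarith)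
  have h2 : (1:ℝ) ≤ Real.exp (τ x ^ 2 / 2) := Real.one_le_exp (by positivity)
  have h3 : Real.exp (-(x ^ 2 / 2)) ≤ Real.exp (-(A ^ 2 / 2)) := Real.exp_le_exp.2 (by nlinarith)
  have h4 : Real.exp (-(B ^ 2 / 2)) ≤ Real.exp (-(y ^ 2 / 2)) := Real.exp_le_exp.2 (by nlinarith)
  have h5 : (A ^ 2 - B ^ 2) / 4 ≤ Real.exp (-(B ^ 2 / 2)) - Real.exp (-(A ^ 2 / 2)) := by
    have : Real.exp (-(B ^ 2 / 2)) = Real.exp (-(A ^ 2 / 2)) * Real.exp ((A ^ 2 - B ^ 2) / 2) := by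
      rw [← Real.exp_add]; congr 1; ring
    rw [this]
    have h6 := Real.add_one_le_exp ((A ^ 2 - B ^ 2) / 2)
    have h7 := Real.add_one_le_exp (-(A ^ 2 / 2))
    have h8 : 0 < Real.exp (-(A ^ 2 / 2)) := Real.exp_pos _
    have h9 : 0 ≤ A ^ 2 - B ^ 2 := by nlinarith
    have h10 : (1:ℝ)/2 ≤ Real.exp (-(A ^ 2 / 2)) := by nlinarith
    nlinarith
  rw [e1, e1]
  have hx0 := Real.exp_pos (-(x ^ 2 / 2))
  have hy0 := Real.exp_pos (-(y ^ 2 / 2))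
  have h9 : 0 ≤ A ^ 2 - B ^ 2 := by nlinarith
  have : (A ^ 2 - B ^ 2) / 4 ≤ Real.exp (τ y ^ 2 / 2) * Real.exp (-(y ^ 2 / 2)) - Real.exp (τ x ^ 2 / 2) * Real.exp (-(x ^ 2 / 2)) := by
    have a1 : Real.exp (τ x ^ 2 / 2) * Real.exp (-(y ^ 2 / 2)) ≤ Real.exp (τ y ^ 2 / 2) * Real.exp (-(y ^ 2 / 2)) :=
      mul_le_mul_of_nonneg_right h1 hy0.le
    have a2 : 1 * (Real.exp (-(y ^ 2 / 2)) - Real.exp (-(x ^ 2 / 2))) ≤ Real.exp (τ x ^ 2 / 2) * (Real.exp (-(y ^ 2 / 2)) - Real.exp (-(x ^ 2 / 2))) :=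
      mul_le_mul_of_nonneg_right h2 (by linarith)
    linarith
  nlinarith

lemma gtail_lower {s : ℝ} (h1 : -1 ≤ s) (h2 : s ≤ 0) : 1 / 20 ≤ gtail (-s) / √(2 * Real.pi) ∧
    gtail (-s) / √(2 * Real.pi) ≤ 1 / 2 := by
  have hp : (0:ℝ) < √(2 * Real.pi) := by positivity
  have hp3 : √(2 * Real.pi) ≤ 2.51 := by
    rw [Real.sqrt_le_left (by norm_num)]
    nlinarith [Real.pi_lt_d4]
  constructor
  · rw [le_div_iff₀ hp]
    have a1 : gtail 1 ≤ gtail (-s) := gtail_strictAnti.antitone (by linarith)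
    have a2 : Real.exp (-2) ≤ gtail 1 := by
      have : ∫ t in Ioc (1:ℝ) 2, Real.exp (-2) ≤ gtail 1 := by
        calc ∫ t in Ioc (1:ℝ) 2, Real.exp (-2) ≤ ∫ t in Ioc (1:ℝ) 2, Real.exp (-t ^ 2 / 2) := by
              refine setIntegral_mono_on (by simp) gexp_integrable.integrableOn measurableSet_Ioc fun t ht => ?_
              apply Real.exp_le_exp.2
              nlinarith [ht.1, ht.2]
          _ ≤ gtail 1 := setIntegral_mono_set gexp_integrable.integrableOn
              (Filter.Eventually.of_forall fun _ => (Real.exp_pos _).le)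
              (Filter.Eventually.of_forall fun t ht => ht.1)
      simp at this
      norm_num at this
      exact this
    have a3 : (0.13:ℝ) ≤ Real.exp (-2) := by
      rw [show (-2:ℝ) = (-1) + (-1) by norm_num, Real.exp_add]
      have := Real.exp_neg_one_gt_d9
      nlinarith
    linarith
  · rw [div_le_iff₀ hp]
    have := gtail_strictAnti.antitone (show (0:ℝ) ≤ -s by linarith)
    rw [gtail_zero] at this
    linarith

section LinAlg
set_option linter.unusedSectionVars false
variable {F : Type*} [NormedAddCommGroup F] [InnerProductSpace ℝ F] [FiniteDimensional ℝ F]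
  {ι : Type*} [Fintype ι]

lemma frame_inner {v : ι → F} {C : ι → ℝ} (hiso : ∀ y, ‖y‖ ^ 2 = ∑ i, C i * ⟪v i, y⟫ ^ 2) (x y : F) :
    ∑ i, C i * ⟪v i, x⟫ * ⟪v i, y⟫ = ⟪x, y⟫ := by
  have h1 := hiso (x + y)
  rw [norm_add_sq_real, hiso x, hiso y] at h1
  simp only [inner_add_right] at h1
  have h2 : ∑ i, C i * (⟪v i, x⟫ + ⟪v i, y⟫) ^ 2 = ∑ i, C i * ⟪v i, x⟫ ^ 2 +
      2 * ∑ i, C i * ⟪v i, x⟫ * ⟪v i, y⟫ + ∑ i, C i * ⟪v i, y⟫ ^ 2 := by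
    rw [Finset.mul_sum, ← Finset.sum_add_distrib, ← Finset.sum_add_distrib]
    refine Finset.sum_congr rfl fun i _ => by ring
  linarith

lemma frame_sum {v : ι → F} {C : ι → ℝ} (hiso : ∀ y, ‖y‖ ^ 2 = ∑ i, C i * ⟪v i, y⟫ ^ 2) (x : F) :
    ∑ i, (C i * ⟪v i, x⟫) • v i = x := by
  refine ext_inner_right ℝ fun y => ?_
  rw [sum_inner, ← frame_inner hiso x y]
  simp [inner_smul_left]

lemma frame_norm_le {v : ι → F} {C : ι → ℝ} (hC : ∀ i, 0 < C i)
    (hiso : ∀ y, ‖y‖ ^ 2 = ∑ i, C i * ⟪v i, y⟫ ^ 2) (θ : ι → ℝ) :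
    ‖∑ i, (C i * θ i) • v i‖ ^ 2 ≤ ∑ i, C i * θ i ^ 2 := by
  set w := ∑ i, (C i * θ i) • v i with hw
  have h1 : ∑ i, C i * θ i * ⟪v i, w⟫ = ‖w‖ ^ 2 := by
    rw [← real_inner_self_eq_norm_sq w]
    conv_rhs => rw [hw, sum_inner]
    simp only [inner_smul_left, ← hw]
    simp
  have h2 : 0 ≤ ∑ i, C i * (θ i - ⟪v i, w⟫) ^ 2 :=
    Finset.sum_nonneg fun i _ => mul_nonneg (hC i).le (sq_nonneg _)
  have h3 : ∑ i, C i * (θ i - ⟪v i, w⟫) ^ 2 = ∑ i, C i * θ i ^ 2 - 2 * ∑ i, C i * θ i * ⟪v i, w⟫ +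
      ∑ i, C i * ⟪v i, w⟫ ^ 2 := by
    rw [Finset.mul_sum, ← Finset.sum_sub_distrib, ← Finset.sum_add_distrib]
    refine Finset.sum_congr rfl fun i _ => by ring
  rw [h3, h1, ← hiso w] at h2
  linarith

lemma frame_total {v : ι → F} {C : ι → ℝ} (hv : ∀ i, ‖v i‖ = 1)
    (hiso : ∀ y, ‖y‖ ^ 2 = ∑ i, C i * ⟪v i, y⟫ ^ 2) :
    ∑ i, C i = Module.finrank ℝ F := by
  have b := stdOrthonormalBasis ℝ F
  have h : ∑ a, ‖b a‖ ^ 2 = ∑ a, ∑ i, C i * ⟪v i, b a⟫ ^ 2 := Finset.sum_congr rfl fun a _ => hiso _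
  rw [Finset.sum_comm] at h
  simp_rw [← Finset.mul_sum, b.sum_sq_inner_left, hv] at h
  simpa using h.symm

lemma frame_le_one {v : ι → F} {C : ι → ℝ} (hv : ∀ i, ‖v i‖ = 1) (hC : ∀ i, 0 < C i)
    (hiso : ∀ y, ‖y‖ ^ 2 = ∑ i, C i * ⟪v i, y⟫ ^ 2) (i : ι) : C i ≤ 1 := by
  have h := hiso (v i)
  have h2 := Finset.single_le_sum (f := fun j => C j * ⟪v j, v i⟫ ^ 2)
    (fun j _ => mul_nonneg (hC j).le (sq_nonneg _)) (Finset.mem_univ i)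
  simp only [real_inner_self_eq_norm_sq, hv] at h2 h
  linarith

/-- The operator `∑ C_i t_i v_i ⊗ v_i`. -/
def frameOp (v : ι → F) (C t : ι → ℝ) : F →L[ℝ] F :=
  ∑ i, (C i * t i) • (innerSL ℝ (v i)).smulRight (v i)

lemma frameOp_apply (v : ι → F) (C t : ι → ℝ) (x : F) :
    frameOp v C t x = ∑ i, (C i * t i * ⟪v i, x⟫) • v i := by
  simp [frameOp, smul_smul]

lemma frameOp_inner (v : ι → F) (C t : ι → ℝ) (x y : F) :
    ⟪frameOp v C t x, y⟫ = ∑ i, C i * t i * ⟪v i, x⟫ * ⟪v i, y⟫ := by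
  simp [frameOp_apply, sum_inner, inner_smul_left]

lemma frameOp_symm (v : ι → F) (C t : ι → ℝ) : (frameOp v C t : F →ₗ[ℝ] F).IsSymmetric := by
  intro x y
  simp only [ContinuousLinearMap.coe_coe]
  rw [real_inner_comm (frameOp v C t y) x, frameOp_inner, frameOp_inner]
  refine Finset.sum_congr rfl fun i _ => by ring

lemma log_strong {t m : ℝ} (ht : 0 < t) (ht1 : t ≤ 1) (hm : 0 < m) (hm1 : m ≤ 1) :
    Real.log t + (t - m) ^ 2 / 4 ≤ Real.log m + (t - m) / m := by
  have hs := Real.sqrt_pos.2 ht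
  have hr := Real.sqrt_pos.2 hm
  set a := √t with ha
  set b := √m with hb
  have ea : a ^ 2 = t := Real.sq_sqrt ht.le
  have eb : b ^ 2 = m := Real.sq_sqrt hm.le
  have h1 : Real.log (a / b) ≤ a / b - 1 := Real.log_le_sub_one_of_pos (by positivity)
  rw [Real.log_div hs.ne' hr.ne'] at h1
  have h2 : Real.log t = 2 * Real.log a := by rw [← ea, Real.log_pow]; norm_num
  have h3 : Real.log m = 2 * Real.log b := by rw [← eb, Real.log_pow]; norm_num
  have ha1 : a ≤ 1 := Real.sqrt_le_one.2 ht1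
  have hb1 : b ≤ 1 := Real.sqrt_le_one.2 hm1
  rw [h2, h3, ← ea, ← eb]
  have h4 : (a ^ 2 - b ^ 2) / b ^ 2 - 2 * (a / b - 1) = (a - b) ^ 2 / b ^ 2 := by
    field_simp; ring
  have h5 : (a ^ 2 - b ^ 2) ^ 2 / 4 ≤ (a - b) ^ 2 / b ^ 2 := by
    rw [le_div_iff₀ (by positivity)]
    have : (a + b) ^ 2 * b ^ 2 ≤ 4 := by
      have : (a + b) * b ≤ 2 := by nlinarith
      have h0 : 0 ≤ (a + b) * b := by positivity
      nlinarith
    nlinarith [sq_nonneg (a - b), mul_nonneg (sq_nonneg (a - b)) (sub_nonneg.2 this)]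
  linarith

lemma frame_logdet {v : ι → F} {C t : ι → ℝ} (hv : ∀ i, ‖v i‖ = 1) (hC : ∀ i, 0 < C i)
    (hiso : ∀ y, ‖y‖ ^ 2 = ∑ i, C i * ⟪v i, y⟫ ^ 2) (ht : ∀ i, 0 < t i) (ht1 : ∀ i, t i ≤ 1) :
    0 < (frameOp v C t).det ∧
    ∑ i, C i * Real.log (t i) + (∑ i, C i * ‖frameOp v C t (v i) - t i • v i‖ ^ 2) / 4 ≤
      Real.log (frameOp v C t).det := by
  have hs := frameOp_symm v C t
  set M := frameOp v C t with hM
  set b := hs.eigenvectorBasis rfl with hb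
  set m := hs.eigenvalues rfl with hm
  have hMb : ∀ a, M (b a) = m a • b a := fun a => hs.apply_eigenvectorBasis rfl a
  have hmq : ∀ a, m a = ∑ i, C i * ⟪v i, b a⟫ ^ 2 * t i := by
    intro a
    have h1 : ⟪M (b a), b a⟫ = m a := by
      rw [hMb, inner_smul_left, real_inner_self_eq_norm_sq, b.norm_eq_one]; simp
    rw [← h1, hM, frameOp_inner]
    refine Finset.sum_congr rfl fun i _ => by ring
  have hq1 : ∀ a, ∑ i, C i * ⟪v i, b a⟫ ^ 2 = 1 := by
    intro a; rw [← hiso, b.norm_eq_one]; norm_num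
  have hq0 : ∀ a i, 0 ≤ C i * ⟪v i, b a⟫ ^ 2 := fun a i => mul_nonneg (hC i).le (sq_nonneg _)
  have hm1 : ∀ a, m a ≤ 1 := by
    intro a
    rw [hmq, ← hq1 a]
    exact Finset.sum_le_sum fun i _ => by nlinarith [hq0 a i, ht1 i]
  have hm0 : ∀ a, 0 < m a := by
    intro a
    rw [hmq]
    refine lt_of_le_of_ne (Finset.sum_nonneg fun i _ => mul_nonneg (hq0 a i) (ht i).le) fun h => ?_
    have h2 := (Finset.sum_eq_zero_iff_of_nonneg (fun i _ => mul_nonneg (hq0 a i) (ht i).le)).1 h.symm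
    have : ∑ i, C i * ⟪v i, b a⟫ ^ 2 = 0 := Finset.sum_eq_zero fun i hi => by
      have := h2 i hi
      rcases mul_eq_zero.1 this with h | h
      · exact h
      · exact absurd h (ht i).ne'
    rw [hq1] at this
    norm_num at this
  have hdet : M.det = ∏ a, m a := by
    have := hs.det_eq_prod_eigenvalues rfl
    simpa using this
  rw [hdet]
  refine ⟨Finset.prod_pos fun a _ => hm0 a, ?_⟩
  rw [Real.log_prod (fun a _ => (hm0 a).ne')]
  have hA : ∀ a, ∑ i, C i * ⟪v i, b a⟫ ^ 2 * Real.log (t i) +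
      ∑ i, C i * ⟪v i, b a⟫ ^ 2 * ((t i - m a) ^ 2 / 4) ≤ Real.log (m a) := by
    intro a
    have h1 : ∀ i, C i * ⟪v i, b a⟫ ^ 2 * (Real.log (t i) + (t i - m a) ^ 2 / 4) ≤
        C i * ⟪v i, b a⟫ ^ 2 * (Real.log (m a) + (t i - m a) / m a) := fun i =>
      mul_le_mul_of_nonneg_left (log_strong (ht i) (ht1 i) (hm0 a) (hm1 a)) (hq0 a i)
    have h2 := Finset.sum_le_sum fun i (_ : i ∈ Finset.univ) => h1 i
    have h3 : ∑ i, C i * ⟪v i, b a⟫ ^ 2 * (Real.log (m a) + (t i - m a) / m a) = Real.log (m a) := by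
      have : ∀ i, C i * ⟪v i, b a⟫ ^ 2 * (Real.log (m a) + (t i - m a) / m a) =
        C i * ⟪v i, b a⟫ ^ 2 * (Real.log (m a) - 1) + C i * ⟪v i, b a⟫ ^ 2 * t i / m a := by
        intro i; have := (hm0 a).ne'; field_simp; ring
      simp_rw [this]
      rw [Finset.sum_add_distrib, ← Finset.sum_mul, hq1, ← Finset.sum_div, ← hmq, div_self (hm0 a).ne']
      ring
    rw [h3] at h2
    simp_rw [mul_add] at h2
    rwa [Finset.sum_add_distrib] at h2
  have hB := Finset.sum_le_sum fun a (_ : a ∈ Finset.univ) => hA a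
  rw [Finset.sum_add_distrib] at hB
  refine le_trans (le_of_eq ?_) hB
  congr 1
  · rw [Finset.sum_comm]
    refine Finset.sum_congr rfl fun i _ => ?_
    rw [← Finset.sum_mul, ← Finset.mul_sum, b.sum_sq_inner_left, hv]; ring
  · rw [Finset.sum_comm, Finset.sum_div]
    refine Finset.sum_congr rfl fun i _ => ?_
    rw [← b.sum_sq_inner_left, mul_div_assoc, Finset.sum_div, Finset.mul_sum]
    refine Finset.sum_congr rfl fun a _ => ?_
    have : ⟪M (v i) - t i • v i, b a⟫ = (m a - t i) * ⟪v i, b a⟫ := by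
      rw [inner_sub_left]
      have h1 : ⟪M (v i), b a⟫ = ⟪v i, M (b a)⟫ := hs (v i) (b a)
      rw [h1, hMb, inner_smul_left, inner_smul_right]
      simp; ring
    rw [this]; ring

lemma frame_det_pair {v : ι → F} {C t : ι → ℝ} (hv : ∀ i, ‖v i‖ = 1) (hC : ∀ i, 0 < C i)
    (hiso : ∀ y, ‖y‖ ^ 2 = ∑ i, C i * ⟪v i, y⟫ ^ 2) (ht : ∀ i, 0 < t i) (ht1 : ∀ i, t i ≤ 1)
    {κ : ℝ} (hκ : 0 ≤ κ) {i j : ι} (hij : i ≠ j) (hi : κ ≤ C i) (hj : κ ≤ C j) :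
    Real.exp (∑ i, C i * Real.log (t i)) * (1 + κ / 8 * (t i - t j) ^ 2 * ⟪v i, v j⟫ ^ 2) ≤
      (frameOp v C t).det := by
  obtain ⟨h0, h1⟩ := frame_logdet hv hC hiso ht ht1
  have hs := frameOp_symm v C t
  set M := frameOp v C t with hM
  set A := ‖M (v i) - t i • v i‖ with hA
  set B := ‖M (v j) - t j • v j‖ with hB
  have h2 : κ * A ^ 2 + κ * B ^ 2 ≤ ∑ i, C i * ‖M (v i) - t i • v i‖ ^ 2 := by
    classical
    calc κ * A ^ 2 + κ * B ^ 2 ≤ C i * A ^ 2 + C j * B ^ 2 := by gcongr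
      _ = ∑ l ∈ {i, j}, C l * ‖M (v l) - t l • v l‖ ^ 2 := by rw [Finset.sum_pair hij]
      _ ≤ _ := Finset.sum_le_sum_of_subset_of_nonneg (Finset.subset_univ _)
        fun l _ _ => mul_nonneg (hC l).le (sq_nonneg _)
  have h3 : (t i - t j) * ⟪v i, v j⟫ = -⟪M (v i) - t i • v i, v j⟫ + ⟪v i, M (v j) - t j • v j⟫ := by
    have : ⟪M (v i), v j⟫ = ⟪v i, M (v j)⟫ := hs _ _
    simp only [inner_sub_left, inner_sub_right, this, inner_smul_left, inner_smul_right]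
    simp; ring
  have h4 : |(t i - t j) * ⟪v i, v j⟫| ≤ A + B := by
    rw [h3]
    refine (abs_add_le _ _).trans (add_le_add ?_ ?_)
    · rw [abs_neg]
      refine (abs_real_inner_le_norm _ _).trans ?_
      rw [hv]; simp [hA]
    · refine (abs_real_inner_le_norm _ _).trans ?_
      rw [hv]; simp [hB]
  have h5 : (t i - t j) ^ 2 * ⟪v i, v j⟫ ^ 2 ≤ 2 * (A ^ 2 + B ^ 2) := by
    rw [← mul_pow, ← sq_abs]
    have : |(t i - t j) * ⟪v i, v j⟫| ^ 2 ≤ (A + B) ^ 2 := by gcongr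
    nlinarith [sq_nonneg (A - B)]
  have h6 : ∑ i, C i * Real.log (t i) + κ / 8 * (t i - t j) ^ 2 * ⟪v i, v j⟫ ^ 2 ≤ Real.log M.det := by
    nlinarith [mul_le_mul_of_nonneg_left h5 hκ]
  calc _ ≤ Real.exp (∑ i, C i * Real.log (t i)) * Real.exp (κ / 8 * (t i - t j) ^ 2 * ⟪v i, v j⟫ ^ 2) := by
        gcongr
        rw [add_comm]; exact Real.add_one_le_exp _
    _ ≤ Real.exp (Real.log M.det) := by rw [← Real.exp_add]; exact Real.exp_le_exp.2 h6
    _ = _ := Real.exp_log h0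

lemma frame_det_ge {v : ι → F} {C t : ι → ℝ} (hv : ∀ i, ‖v i‖ = 1) (hC : ∀ i, 0 < C i)
    (hiso : ∀ y, ‖y‖ ^ 2 = ∑ i, C i * ⟪v i, y⟫ ^ 2) (ht : ∀ i, 0 < t i) (ht1 : ∀ i, t i ≤ 1) :
    Real.exp (∑ i, C i * Real.log (t i)) ≤ (frameOp v C t).det := by
  obtain ⟨h0, h1⟩ := frame_logdet hv hC hiso ht ht1
  have : 0 ≤ ∑ i, C i * ‖frameOp v C t (v i) - t i • v i‖ ^ 2 :=
    Finset.sum_nonneg fun l _ => mul_nonneg (hC l).le (sq_nonneg _)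
  calc _ ≤ Real.exp (Real.log (frameOp v C t).det) := Real.exp_le_exp.2 (by linarith)
    _ = _ := Real.exp_log h0

end LinAlg

section Transport
set_option linter.unusedSectionVars false
variable {F : Type*} [NormedAddCommGroup F] [InnerProductSpace ℝ F] [FiniteDimensional ℝ F]
  [MeasurableSpace F] [BorelSpace F]
  {ι : Type*} [Fintype ι]

lemma integral_onb_prod (b : OrthonormalBasis ι ℝ F) (f : ℝ → ℝ) :
    ∫ y : F, ∏ j, f ⟪b j, y⟫ = (∫ t, f t) ^ Fintype.card ι := by
  have h1 := b.measurePreserving_measurableEquiv.integral_comp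
    b.measurableEquiv.measurableEmbedding (fun y : EuclideanSpace ℝ ι => ∏ j, f (y j))
  have h2 := (EuclideanSpace.volume_preserving_symm_measurableEquiv_toLp ι).integral_comp
    (MeasurableEquiv.toLp 2 (ι → ℝ)).symm.measurableEmbedding (fun y : ι → ℝ => ∏ j, f (y j))
  rw [integral_fintype_prod_volume_eq_pow] at h2
  rw [← h2]
  refine Eq.trans ?_ (h1.trans ?_)
  · refine integral_congr_ae (Filter.Eventually.of_forall fun y => ?_)
    simp only []
    refine Finset.prod_congr rfl fun j _ => ?_
    congr 1
    exact (b.repr_apply_apply y j).symm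
  · rfl

lemma gauss_integral : ∫ y : F, Real.exp (-‖y‖ ^ 2 / 2) = √(2 * Real.pi) ^ Module.finrank ℝ F := by
  have := integral_onb_prod (stdOrthonormalBasis ℝ F) (fun t => Real.exp (-t ^ 2 / 2))
  rw [gexp_integral, Fintype.card_fin] at this
  rw [← this]
  congr 1; ext y
  rw [← Real.exp_sum, ← Finset.sum_div, Finset.sum_neg_distrib,
    (stdOrthonormalBasis ℝ F).sum_sq_inner_right]

lemma gauss_integrable : Integrable (fun y : F => Real.exp (-‖y‖ ^ 2 / 2)) := by
  by_contra h
  have := integral_undef h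
  rw [gauss_integral] at this
  have h2 : 0 < √(2 * Real.pi) ^ Module.finrank ℝ F := by positivity
  linarith

lemma transport_main {v : ι → F} {C : ι → ℝ} (hv : ∀ i, ‖v i‖ = 1) (hC : ∀ i, 0 < C i)
    (hiso : ∀ y, ‖y‖ ^ 2 = ∑ i, C i * ⟪v i, y⟫ ^ 2) {q : ℝ} {τ : ℝ → ℝ} (hq0 : 0 < q)
    (hd : ∀ x, HasDerivAt τ (q * Real.exp ((τ x ^ 2 - x ^ 2) / 2)) x) (hm : StrictMono τ)
    (S : Set F) (hS : ∀ z : F, ∑ i, (C i * τ ⟪v i, z⟫) • v i ∈ S)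
    (B : Set F) (hB : MeasurableSet B) {κ : ℝ} 
    (hd0 : ∀ z : F, Real.exp (∑ i, C i * Real.log (q * Real.exp ((τ ⟪v i, z⟫ ^ 2 - ⟪v i, z⟫ ^ 2) / 2))) ≤
      (frameOp v C fun i => q * Real.exp ((τ ⟪v i, z⟫ ^ 2 - ⟪v i, z⟫ ^ 2) / 2)).det)
    (hdB : ∀ z ∈ B, Real.exp (∑ i, C i * Real.log (q * Real.exp ((τ ⟪v i, z⟫ ^ 2 - ⟪v i, z⟫ ^ 2) / 2))) * (1 + κ) ≤
      (frameOp v C fun i => q * Real.exp ((τ ⟪v i, z⟫ ^ 2 - ⟪v i, z⟫ ^ 2) / 2)).det) :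
    q ^ Module.finrank ℝ F * (√(2 * Real.pi) ^ Module.finrank ℝ F + κ * ∫ z in B, Real.exp (-‖z‖ ^ 2 / 2)) ≤
      ∫ y in S, Real.exp (-‖y‖ ^ 2 / 2) := by
  set Ψ : F → F := fun z => ∑ i, (C i * τ ⟪v i, z⟫) • v i with hΨ
  set t : F → ι → ℝ := fun z i => q * Real.exp ((τ ⟪v i, z⟫ ^ 2 - ⟪v i, z⟫ ^ 2) / 2) with ht
  have hder : ∀ z, HasFDerivAt Ψ (frameOp v C (t z)) z := by
    intro z
    unfold frameOp
    refine HasFDerivAt.fun_sum fun i _ => ?_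
    have h1 : HasFDerivAt (fun z : F => ⟪v i, z⟫) (innerSL ℝ (v i)) z := (innerSL ℝ (v i)).hasFDerivAt
    have h2 := (((hd ⟪v i, z⟫).comp_hasFDerivAt z h1).const_mul (C i)).smul_const (v i)
    refine h2.congr_fderiv (ContinuousLinearMap.ext fun x => ?_)
    simp [ht, smul_smul, mul_assoc]
  have hinj : Function.Injective Ψ := by
    intro x y hxy
    have h1 : ⟪Ψ x - Ψ y, x - y⟫ = 0 := by rw [hxy]; simp
    have h2 : ⟪Ψ x - Ψ y, x - y⟫ = ∑ i, C i * ((τ ⟪v i, x⟫ - τ ⟪v i, y⟫) * (⟪v i, x⟫ - ⟪v i, y⟫)) := by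
      rw [hΨ, ← Finset.sum_sub_distrib, sum_inner]
      refine Finset.sum_congr rfl fun i _ => ?_
      rw [← sub_smul, inner_smul_left, inner_sub_right]; simp; ring
    have hnn : ∀ i, 0 ≤ C i * ((τ ⟪v i, x⟫ - τ ⟪v i, y⟫) * (⟪v i, x⟫ - ⟪v i, y⟫)) := by
      intro i
      refine mul_nonneg (hC i).le ?_
      rcases le_total ⟪v i, x⟫ ⟪v i, y⟫ with h | h
      · exact mul_nonneg_of_nonpos_of_nonpos (sub_nonpos.2 (hm.monotone h)) (sub_nonpos.2 h)
      · exact mul_nonneg (sub_nonneg.2 (hm.monotone h)) (sub_nonneg.2 h)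
    rw [h1] at h2
    have h3 := (Finset.sum_eq_zero_iff_of_nonneg (fun i _ => hnn i)).1 h2.symm
    have h4 : ∀ i, ⟪v i, x - y⟫ = 0 := by
      intro i
      rw [inner_sub_right]
      have := h3 i (Finset.mem_univ i)
      rcases mul_eq_zero.1 this with h | h
      · exact absurd h (hC i).ne'
      · rcases mul_eq_zero.1 h with h | h
        · exact sub_eq_zero.2 (hm.injective (sub_eq_zero.1 h))
        · exact h
    have h5 := hiso (x - y)
    simp only [h4] at h5
    simp at h5
    exact sub_eq_zero.1 h5
  have himg := integral_image_eq_integral_abs_det_fderiv_smul volume MeasurableSet.univ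
    (fun x _ => (hder x).hasFDerivWithinAt) hinj.injOn (fun y : F => Real.exp (-‖y‖ ^ 2 / 2))
  have hintg := (integrableOn_image_iff_integrableOn_abs_det_fderiv_smul volume MeasurableSet.univ
    (fun x _ => (hder x).hasFDerivWithinAt) hinj.injOn (fun y : F => Real.exp (-‖y‖ ^ 2 / 2))).1
    gauss_integrable.integrableOn
  have h1 : ∫ y in Ψ '' univ, Real.exp (-‖y‖ ^ 2 / 2) ≤ ∫ y in S, Real.exp (-‖y‖ ^ 2 / 2) := by
    refine setIntegral_mono_set gauss_integrable.integrableOn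
      (Filter.Eventually.of_forall fun _ => (Real.exp_pos _).le) (Filter.Eventually.of_forall ?_)
    rintro y ⟨z, _, rfl⟩
    exact hS z
  refine le_trans ?_ h1
  rw [himg]
  rw [setIntegral_univ]
  rw [integrableOn_univ] at hintg
  have hpt : ∀ z, Real.exp (∑ i, C i * Real.log (t z i)) * Real.exp (-(∑ i, C i * τ ⟪v i, z⟫ ^ 2) / 2) =
      q ^ Module.finrank ℝ F * Real.exp (-‖z‖ ^ 2 / 2) := by
    intro z
    have : q ^ Module.finrank ℝ F = Real.exp (∑ i, C i * Real.log q) := by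
      rw [← Finset.sum_mul, frame_total hv hiso, ← Real.log_pow, Real.exp_log (by positivity)]
    rw [this, ← Real.exp_add, ← Real.exp_add]
    congr 1
    rw [hiso z]
    have hl : ∀ i, Real.log (t z i) = Real.log q + (τ ⟪v i, z⟫ ^ 2 - ⟪v i, z⟫ ^ 2) / 2 := by
      intro i
      rw [ht, Real.log_mul hq0.ne' (Real.exp_ne_zero _), Real.log_exp]
    simp_rw [hl, neg_div, Finset.sum_div, ← sub_eq_add_neg, ← Finset.sum_sub_distrib]
    refine Finset.sum_congr rfl fun i _ => by ring
  have hexp : ∀ z, Real.exp (-(∑ i, C i * τ ⟪v i, z⟫ ^ 2) / 2) ≤ Real.exp (-‖Ψ z‖ ^ 2 / 2) := by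
    intro z
    apply Real.exp_le_exp.2
    have := frame_norm_le hC hiso (fun i => τ ⟪v i, z⟫)
    simp only [hΨ]
    linarith
  have hmono : ∫ z : F, (q ^ Module.finrank ℝ F * Real.exp (-‖z‖ ^ 2 / 2) +
      B.indicator (fun z => q ^ Module.finrank ℝ F * κ * Real.exp (-‖z‖ ^ 2 / 2)) z) ≤
      ∫ z, |(frameOp v C (t z)).det| • Real.exp (-‖Ψ z‖ ^ 2 / 2) := by
    refine integral_mono ((gauss_integrable.const_mul _).add ((gauss_integrable.const_mul _).indicator hB)) hintg
      fun z => ?_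
    simp only [smul_eq_mul]
    have a0 := hd0 z
    have hdp : 0 ≤ (frameOp v C (t z)).det := (Real.exp_pos _).le.trans a0
    rw [abs_of_nonneg hdp]
    refine le_trans ?_ (mul_le_mul_of_nonneg_left (hexp z) hdp)
    by_cases hz : z ∈ B
    · rw [indicator_of_mem hz]
      calc _ = (Real.exp (∑ i, C i * Real.log (t z i)) * (1 + κ)) * Real.exp (-(∑ i, C i * τ ⟪v i, z⟫ ^ 2) / 2) := by
            have h0 := hpt z
            linear_combination (-(1 + κ)) * h0
        _ ≤ _ := mul_le_mul_of_nonneg_right (hdB z hz) (Real.exp_pos _).le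
    · rw [indicator_of_notMem hz, add_zero, ← hpt]
      exact mul_le_mul_of_nonneg_right a0 (Real.exp_pos _).le
  refine le_trans (le_of_eq ?_) hmono
  rw [integral_add (gauss_integrable.const_mul _) ((gauss_integrable.const_mul _).indicator hB),
    integral_const_mul, gauss_integral, integral_indicator hB, integral_const_mul]
  ring

lemma transport_basic {v : ι → F} {C : ι → ℝ} (hv : ∀ i, ‖v i‖ = 1) (hC : ∀ i, 0 < C i)
    (hiso : ∀ y, ‖y‖ ^ 2 = ∑ i, C i * ⟪v i, y⟫ ^ 2) (s : ℝ)
    (S : Set F) (hS : ∀ θ : ι → ℝ, (∀ i, -s < θ i) → ∑ i, (C i * θ i) • v i ∈ S) :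
    gtail (-s) ^ Module.finrank ℝ F ≤ ∫ y in S, Real.exp (-‖y‖ ^ 2 / 2) := by
  have hp : (0:ℝ) < √(2 * Real.pi) := by positivity
  have hq0 : 0 < gtail (-s) / √(2 * Real.pi) := div_pos (gtail_pos _) hp
  have hq1 : gtail (-s) / √(2 * Real.pi) < 1 := (div_lt_one hp).2 (gtail_lt _)
  obtain ⟨τ, h1, h2, h3, h4, h5⟩ := exists_tau _ hq0 hq1
  have hd := fun z : F => frame_det_ge hv hC hiso (t := fun i => gtail (-s) / √(2 * Real.pi) *
    Real.exp ((τ ⟪v i, z⟫ ^ 2 - ⟪v i, z⟫ ^ 2) / 2)) (fun i => mul_pos hq0 (Real.exp_pos _)) (fun i => h4 _)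
  have := transport_main hv hC hiso hq0 h2 h5 S (fun z => hS _ fun i => tau_gt_of (h1 _)) ∅
    MeasurableSet.empty (κ := 0) hd (by simp)
  simp only [zero_mul, add_zero] at this
  rwa [← mul_pow, div_mul_cancel₀ _ hp.ne'] at this

lemma volume_closedBall_ge (z : F) {r : ℝ} (hr : 0 ≤ r) (hN : 0 < Module.finrank ℝ F) :
    (r / Module.finrank ℝ F) ^ Module.finrank ℝ F ≤ volume.real (closedBall z r) := by
  set N := Module.finrank ℝ F with hNdef
  have hN' : (0:ℝ) < N := by exact_mod_cast hN
  have h1 := (stdOrthonormalBasis ℝ F).volume_parallelepiped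
  have hsub : parallelepiped (stdOrthonormalBasis ℝ F) ⊆ closedBall 0 (N:ℝ) := by
    intro x hx
    obtain ⟨t, ht, rfl⟩ := (mem_parallelepiped_iff _ _).1 hx
    rw [mem_closedBall_zero_iff]
    refine (norm_sum_le _ _).trans ?_
    calc _ ≤ ∑ i : Fin (Module.finrank ℝ F), (1:ℝ) := by
          refine Finset.sum_le_sum fun i _ => ?_
          rw [norm_smul, (stdOrthonormalBasis ℝ F).norm_eq_one, mul_one, Real.norm_eq_abs,
            abs_of_nonneg (ht.1 i)]
          exact ht.2 i
      _ = N := by simp [hNdef]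
  have h2 := measure_mono (μ := volume) hsub
  rw [h1, Measure.addHaar_closedBall _ _ hN'.le] at h2
  have h3 := Measure.addHaar_closedBall (volume : Measure F) z hr
  have hfin : volume (ball (0:F) 1) ≠ ⊤ := measure_ball_lt_top.ne
  rw [Measure.real, h3, ENNReal.toReal_mul, ENNReal.toReal_ofReal (by positivity)]
  have h4 : 1 ≤ (N:ℝ) ^ N * (volume (ball (0:F) 1)).toReal := by
    have := (ENNReal.toReal_le_toReal (by simp) (ENNReal.mul_ne_top ENNReal.ofReal_ne_top hfin)).2 h2
    rwa [ENNReal.toReal_mul, ENNReal.toReal_ofReal (by positivity), ENNReal.toReal_one] at this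
  rw [div_pow, ← hNdef, div_le_iff₀ (by positivity)]
  have : 0 ≤ r ^ N := by positivity
  nlinarith

set_option maxHeartbeats 1600000 in
lemma transport_pair {v : ι → F} {C : ι → ℝ} (hv : ∀ i, ‖v i‖ = 1) (hC : ∀ i, 0 < C i)
    (hiso : ∀ y, ‖y‖ ^ 2 = ∑ i, C i * ⟪v i, y⟫ ^ 2) {s : ℝ} (hs1 : -1 ≤ s) (hs2 : s ≤ 0)
    (S : Set F) (hS : ∀ θ : ι → ℝ, (∀ i, -s < θ i) → ∑ i, (C i * θ i) • v i ∈ S)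
    {K : ℝ} (hK : 1 ≤ K) {i j : ι} (hij : i ≠ j) (hi : 1 / K ≤ C i) (hj : 1 / K ≤ C j)
    (hρ : ⟪v i, v j⟫ ^ 2 ≤ 1 - 1 / K) :
    gtail (-s) ^ Module.finrank ℝ F + (1 / 20) ^ (Module.finrank ℝ F + 2) * (⟪v i, v j⟫ ^ 2 *
        (1 / (128 * 12 ^ 4 * K ^ 5)) * ((1 / (48 * K) / Module.finrank ℝ F) ^ Module.finrank ℝ F / 2))
      ≤ ∫ y in S, Real.exp (-‖y‖ ^ 2 / 2) := by
  have hp : (0:ℝ) < √(2 * Real.pi) := by positivity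
  have hq0 : 0 < gtail (-s) / √(2 * Real.pi) := div_pos (gtail_pos _) hp
  have hq1 : gtail (-s) / √(2 * Real.pi) < 1 := (div_lt_one hp).2 (gtail_lt _)
  obtain ⟨hq20, hq2⟩ := gtail_lower hs1 hs2
  obtain ⟨τ, h1, h2, h3, h4, h5⟩ := exists_tau _ hq0 hq1
  have hd := fun z : F => frame_det_ge hv hC hiso (t := fun i => gtail (-s) / √(2 * Real.pi) *
    Real.exp ((τ ⟪v i, z⟫ ^ 2 - ⟪v i, z⟫ ^ 2) / 2)) (fun i => mul_pos hq0 (Real.exp_pos _)) (fun i => h4 _)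
  have hpair := fun z : F => frame_det_pair hv hC hiso (t := fun i => gtail (-s) / √(2 * Real.pi) *
    Real.exp ((τ ⟪v i, z⟫ ^ 2 - ⟪v i, z⟫ ^ 2) / 2)) (fun i => mul_pos hq0 (Real.exp_pos _)) (fun i => h4 _)
    (κ := 1 / K) (by positivity) hij hi hj
  have hmul : ((gtail (-s) / √(2 * Real.pi)) * √(2 * Real.pi)) = gtail (-s) := div_mul_cancel₀ _ hp.ne'
  set q := gtail (-s) / √(2 * Real.pi) with hq
  have hK0 : 0 < K := by linarith
  set ρ := ⟪v i, v j⟫ with hρdef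
  set a := 1 / (12 * K) with ha
  have ha0 : 0 < a := by positivity
  have ha1 : a ≤ 1 / 12 := by
    rw [ha]; apply one_div_le_one_div_of_le <;> linarith
  have hD : 1 / K ≤ 1 - ρ ^ 2 := by linarith
  have hD0 : 0 < 1 - ρ ^ 2 := lt_of_lt_of_le (by positivity) hD
  have hρ1 : |ρ| ≤ 1 := by
    rw [← sq_le_one_iff_abs_le_one]; linarith
  obtain ⟨hρl, hρu⟩ := abs_le.1 hρ1
  set z0 : F := (a * (ρ - 2) / (1 - ρ ^ 2)) • v i + (a * (2 * ρ - 1) / (1 - ρ ^ 2)) • v j with hz0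
  have hii : ∀ l, ⟪v l, v l⟫ = 1 := fun l => by rw [real_inner_self_eq_norm_sq, hv]; norm_num
  have hzi : ⟪v i, z0⟫ = -2 * a := by
    rw [hz0, inner_add_right, inner_smul_right, inner_smul_right, hii, ← hρdef]
    field_simp; ring
  have hzj : ⟪v j, z0⟫ = -a := by
    rw [hz0, inner_add_right, inner_smul_right, inner_smul_right, hii, real_inner_comm, ← hρdef]
    field_simp; ring
  have hinv : 1 / (1 - ρ ^ 2) ≤ K := by
    rw [div_le_iff₀ hD0]
    have := mul_le_mul_of_nonneg_left hD hK0.le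
    rwa [mul_one_div_cancel hK0.ne'] at this
  have hinv0 : 0 < 1 / (1 - ρ ^ 2) := by positivity
  have haK : a * K = 1 / 12 := by rw [ha]; field_simp
  have hz0n : ‖z0‖ ≤ 1 / 2 := by
    have b1 : ‖(a * (ρ - 2) / (1 - ρ ^ 2)) • v i‖ ≤ 3 * (a * K) := by
      rw [norm_smul, hv, mul_one, Real.norm_eq_abs, show a * (ρ - 2) / (1 - ρ ^ 2) = (ρ - 2) * (a * (1 / (1 - ρ ^ 2))) by ring,
        abs_mul, abs_of_pos (mul_pos ha0 hinv0)]
      gcongr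
      rw [abs_le]; constructor <;> linarith
    have b2 : ‖(a * (2 * ρ - 1) / (1 - ρ ^ 2)) • v j‖ ≤ 3 * (a * K) := by
      rw [norm_smul, hv, mul_one, Real.norm_eq_abs, show a * (2 * ρ - 1) / (1 - ρ ^ 2) = (2 * ρ - 1) * (a * (1 / (1 - ρ ^ 2))) by ring,
        abs_mul, abs_of_pos (mul_pos ha0 hinv0)]
      gcongr
      rw [abs_le]; constructor <;> linarith
    refine (norm_add_le _ _).trans ?_
    linarith
  have hr : a / 4 = 1 / (48 * K) := by rw [ha]; field_simp; norm_num
  have hin : ∀ z ∈ closedBall z0 (a / 4), ∀ l, |⟪v l, z⟫ - ⟪v l, z0⟫| ≤ a / 4 := by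
    intro z hz l
    rw [← inner_sub_right]
    refine (abs_real_inner_le_norm _ _).trans ?_
    rw [hv, one_mul, ← dist_eq_norm]; exact hz
  set κ := ρ ^ 2 * (q ^ 2 * (1 / (128 * 12 ^ 4 * K ^ 5))) with hκ
  have hκ0 : 0 ≤ κ := by positivity
  have hmain := transport_main hv hC hiso hq0 h2 h5 S (fun z => hS _ fun i => tau_gt_of (h1 _))
    (closedBall z0 (a / 4)) isClosed_closedBall.measurableSet (κ := κ) hd (by
      intro z hz
      refine le_trans ?_ (hpair z)
      refine mul_le_mul_of_nonneg_left ?_ (Real.exp_pos _).le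
      have b1 := abs_le.1 (hin z hz i)
      have b2 := abs_le.1 (hin z hz j)
      rw [hzi] at b1
      rw [hzj] at b2
      have b3 := tau_deriv_diff hq0 h5 (fun x => tau_pos_of q hq2 (h1 x)) (x := ⟪v i, z⟫) (y := ⟪v j, z⟫)
        (A := 7 * a / 4) (B := 5 * a / 4) (by linarith) (by linarith) (by linarith) (by linarith)
        (by linarith) (by linarith)
      set ti := q * Real.exp ((τ ⟪v i, z⟫ ^ 2 - ⟪v i, z⟫ ^ 2) / 2)
      set tj := q * Real.exp ((τ ⟪v j, z⟫ ^ 2 - ⟪v j, z⟫ ^ 2) / 2)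
      have b4 : q * a ^ 2 / 4 ≤ tj - ti := by
        refine le_trans ?_ b3
        nlinarith [mul_pos hq0 (pow_pos ha0 2)]
      have b5 : (q * a ^ 2 / 4) ^ 2 ≤ (ti - tj) ^ 2 := by
        rw [← neg_sub, neg_sq]
        have : 0 ≤ q * a ^ 2 / 4 := by positivity
        gcongr
      have b6 : κ = 1 / K / 8 * (q * a ^ 2 / 4) ^ 2 * ρ ^ 2 := by
        rw [hκ, ha]; field_simp; ring
      rw [b6]
      gcongr)
  refine le_trans ?_ hmain
  rw [mul_add, ← mul_pow, hmul]
  have hN : 0 < Module.finrank ℝ F := by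
    rcases Nat.eq_zero_or_pos (Module.finrank ℝ F) with h | h
    · have := Module.finrank_zero_iff.1 h
      have h3 := hv i
      rw [Subsingleton.elim (v i) 0] at h3
      simp at h3
    · exact h
  have hvol := volume_closedBall_ge z0 (r := a / 4) (by positivity) hN
  have hintg : volume.real (closedBall z0 (a / 4)) / 2 ≤ ∫ z in closedBall z0 (a / 4), Real.exp (-‖z‖ ^ 2 / 2) := by
    have : ∫ z in closedBall z0 (a / 4), (1/2 : ℝ) ≤ ∫ z in closedBall z0 (a / 4), Real.exp (-‖z‖ ^ 2 / 2) := by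
      refine setIntegral_mono_on ?_ gauss_integrable.integrableOn isClosed_closedBall.measurableSet fun z hz => ?_
      · exact integrableOn_const measure_closedBall_lt_top.ne
      · have : ‖z‖ ≤ 1 := by
          have e : z = z0 + (z - z0) := by abel
          rw [e]
          refine (norm_add_le _ _).trans ?_
          have : ‖z - z0‖ ≤ a / 4 := by rw [← dist_eq_norm]; exact hz
          linarith
        have := Real.add_one_le_exp (-‖z‖ ^ 2 / 2)
        nlinarith [norm_nonneg z]
    simpa [div_eq_mul_inv] using this
  rw [hr] at hvol hintg
  rw [hr]
  refine add_le_add le_rfl ?_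
  have hκle : ρ ^ 2 * ((1/20) ^ 2 * (1 / (128 * 12 ^ 4 * K ^ 5))) ≤ κ := by
    rw [hκ]; gcongr
  calc _ = (1 / 20) ^ Module.finrank ℝ F * ((ρ ^ 2 * ((1/20) ^ 2 * (1 / (128 * 12 ^ 4 * K ^ 5)))) *
        ((1 / (48 * K) / Module.finrank ℝ F) ^ Module.finrank ℝ F / 2)) := by ring
    _ ≤ _ := by
      refine mul_le_mul (pow_le_pow_left₀ (by norm_num) hq20 _)
        (mul_le_mul hκle (by linarith) (by positivity) hκ0) (by positivity) (by positivity)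

end Transport

section Gauge
set_option linter.unusedSectionVars false
variable {E : Type*} [NormedAddCommGroup E] [InnerProductSpace ℝ E] [FiniteDimensional ℝ E]
  {ι : Type*} [Fintype ι]

lemma hull_mem {u : ι → E} {a : ι → ℝ} (ha : ∀ i, 0 ≤ a i) (h1 : ∑ i, a i = 1) :
    ∑ i, a i • u i ∈ convexHull ℝ (range u) :=
  (convex_convexHull ℝ _).sum_mem (fun i _ => ha i) h1
    (fun i _ => subset_convexHull ℝ _ (mem_range_self i))

lemma gauge_hull_le {u : ι → E} {a : ι → ℝ} (ha : ∀ i, 0 ≤ a i) :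
    gauge (convexHull ℝ (range u)) (∑ i, a i • u i) ≤ ∑ i, a i := by
  have h0 : 0 ≤ ∑ i, a i := Finset.sum_nonneg fun i _ => ha i
  rcases h0.eq_or_lt with h | h
  · have hz := (Finset.sum_eq_zero_iff_of_nonneg (fun i _ => ha i)).1 h.symm
    have : ∑ i, a i • u i = 0 := Finset.sum_eq_zero fun i hi => by rw [hz i hi, zero_smul]
    rw [this, gauge_zero]; exact h0
  · refine gauge_le_of_mem h0 ?_
    refine ⟨∑ i, (a i / ∑ j, a j) • u i, hull_mem (fun i => div_nonneg (ha i) h0) ?_, ?_⟩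
    · rw [← Finset.sum_div, div_self h.ne']
    · simp only [Finset.smul_sum, smul_smul]
      refine Finset.sum_congr rfl fun i _ => ?_
      congr 1
      field_simp

lemma frame_shift {u : ι → E} {c : ι → ℝ} 
    (hiso : ∀ x : E, ‖x‖ ^ 2 = ∑ i, c i * ⟪u i, x⟫ ^ 2) (hcent : ∑ i, c i • u i = 0) (x : E) (r : ℝ) :
    ∑ i, (c i * (⟪u i, x⟫ + r)) • u i = x := by
  have h := frame_sum hiso x
  simp only [mul_add, add_smul, Finset.sum_add_distrib, h]
  simp only [mul_comm _ r, mul_smul, ← Finset.smul_sum, hcent]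
  simp

lemma frame_shift_sum {u : ι → E} {c : ι → ℝ} (hu : ∀ i, ‖u i‖ = 1)
    (hiso : ∀ x : E, ‖x‖ ^ 2 = ∑ i, c i * ⟪u i, x⟫ ^ 2) (hcent : ∑ i, c i • u i = 0) (x : E) (r : ℝ) :
    ∑ i, c i * (⟪u i, x⟫ + r) = Module.finrank ℝ E * r := by
  have h1 : ∑ i, c i * ⟪u i, x⟫ = 0 := by
    have : ⟪∑ i, c i • u i, x⟫ = ∑ i, c i * ⟪u i, x⟫ := by
      rw [sum_inner]; simp [inner_smul_left]
    rw [← this, hcent, inner_zero_left]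
  simp only [mul_add, Finset.sum_add_distrib, h1, ← Finset.sum_mul, frame_total hu hiso]
  ring

lemma gauge_hull_le_norm {u : ι → E} {c : ι → ℝ} (hu : ∀ i, ‖u i‖ = 1) (hc : ∀ i, 0 < c i)
    (hiso : ∀ x : E, ‖x‖ ^ 2 = ∑ i, c i * ⟪u i, x⟫ ^ 2) (hcent : ∑ i, c i • u i = 0) (x : E) :
    gauge (convexHull ℝ (range u)) x ≤ Module.finrank ℝ E * ‖x‖ := by
  have := gauge_hull_le (u := u) (a := fun i => c i * (⟪u i, x⟫ + ‖x‖)) (fun i => by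
    refine mul_nonneg (hc i).le ?_
    have := abs_le.1 (abs_real_inner_le_norm (u i) x)
    rw [hu, one_mul] at this
    linarith)
  rwa [frame_shift hiso hcent, frame_shift_sum hu hiso hcent] at this

lemma hull_nhds {u : ι → E} {c : ι → ℝ} (hu : ∀ i, ‖u i‖ = 1) (hc : ∀ i, 0 < c i)
    (hiso : ∀ x : E, ‖x‖ ^ 2 = ∑ i, c i * ⟪u i, x⟫ ^ 2) (hcent : ∑ i, c i • u i = 0)
    (hn : 0 < Module.finrank ℝ E) :
    convexHull ℝ (range u) ∈ nhds (0 : E) := by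
  have hn' : (0:ℝ) < Module.finrank ℝ E := by exact_mod_cast hn
  refine Filter.mem_of_superset (closedBall_mem_nhds 0 (ε := 1 / Module.finrank ℝ E) (by positivity)) fun x hx => ?_
  rw [mem_closedBall_zero_iff] at hx
  rw [← frame_shift hiso hcent x (1 / Module.finrank ℝ E)]
  refine hull_mem (fun i => ?_) ?_
  · refine mul_nonneg (hc i).le ?_
    have := abs_le.1 (abs_real_inner_le_norm (u i) x)
    rw [hu, one_mul] at this
    linarith
  · rw [frame_shift_sum hu hiso hcent]
    field_simp

lemma gauge_hull_ge {u : ι → E} (h0 : convexHull ℝ (range u) ∈ nhds (0 : E)) (z : E)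
    (hz : ∀ i, ⟪z, u i⟫ ≤ 1) (x : E) : ⟪z, x⟫ ≤ gauge (convexHull ℝ (range u)) x := by
  refine le_csInf (absorbent_nhds_zero h0).gauge_set_nonempty ?_
  rintro r ⟨hr, y, hy, rfl⟩
  simp only [inner_smul_right]
  have : convexHull ℝ (range u) ⊆ {y | ⟪z, y⟫ ≤ 1} := by
    refine convexHull_min ?_ ?_
    · rintro _ ⟨i, rfl⟩; exact hz i
    · exact convex_halfSpace_le (innerSL ℝ z).toLinearMap.isLinear 1
  have := this hy
  simp only [mem_setOf_eq] at this
  have hr' : 0 < r := hr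
  nlinarith

end Gauge

section Lift
set_option linter.unusedSectionVars false
variable {E : Type*} [NormedAddCommGroup E] [InnerProductSpace ℝ E] [FiniteDimensional ℝ E]
  {ι : Type*} [Fintype ι]

def liftV (u : ι → E) (i : ι) : WithLp 2 (E × ℝ) :=
  WithLp.toLp 2 (√((Module.finrank ℝ E : ℝ) / (Module.finrank ℝ E + 1)) • u i, 1 / √((Module.finrank ℝ E : ℝ) + 1))

lemma liftV_inner (u : ι → E) (i : ι) (y : WithLp 2 (E × ℝ)) :
    ⟪liftV u i, y⟫ = √((Module.finrank ℝ E : ℝ) / (Module.finrank ℝ E + 1)) * ⟪u i, y.fst⟫ +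
      1 / √((Module.finrank ℝ E : ℝ) + 1) * y.snd := by
  rw [WithLp.prod_inner_apply]
  simp [liftV, inner_smul_left]
  ring

lemma liftV_inner_liftV (u : ι → E) (i j : ι) :
    ⟪liftV u i, liftV u j⟫ = ((Module.finrank ℝ E : ℝ) * ⟪u i, u j⟫ + 1) / (Module.finrank ℝ E + 1) := by
  rw [liftV_inner]
  have h1 : (0:ℝ) ≤ (Module.finrank ℝ E : ℝ) / (Module.finrank ℝ E + 1) := by positivity
  have h2 : (0:ℝ) ≤ (Module.finrank ℝ E : ℝ) + 1 := by positivity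
  have e1 : (liftV u j).fst = √((Module.finrank ℝ E : ℝ) / (Module.finrank ℝ E + 1)) • u j := rfl
  have e2 : (liftV u j).snd = 1 / √((Module.finrank ℝ E : ℝ) + 1) := rfl
  rw [e1, e2, inner_smul_right, ← mul_assoc, Real.mul_self_sqrt h1, ← mul_div_mul_comm, Real.mul_self_sqrt h2]
  ring

lemma liftV_norm {u : ι → E} (hu : ∀ i, ‖u i‖ = 1) (i : ι) : ‖liftV u i‖ = 1 := by
  have h : ‖liftV u i‖ ^ 2 = 1 := by
    rw [← real_inner_self_eq_norm_sq, liftV_inner_liftV, real_inner_self_eq_norm_sq, hu]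
    have h2 : (0:ℝ) < (Module.finrank ℝ E : ℝ) + 1 := by positivity
    field_simp
  have h0 := norm_nonneg (liftV u i)
  nlinarith

lemma lift_finrank : Module.finrank ℝ (WithLp 2 (E × ℝ)) = Module.finrank ℝ E + 1 := by
  rw [(WithLp.linearEquiv 2 ℝ (E × ℝ)).finrank_eq, Module.finrank_prod, Module.finrank_self]

lemma lift_frame {u : ι → E} {c : ι → ℝ} (hu : ∀ i, ‖u i‖ = 1)
    (hiso : ∀ x : E, ‖x‖ ^ 2 = ∑ i, c i * ⟪u i, x⟫ ^ 2) (hcent : ∑ i, c i • u i = 0)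
    (hn : 0 < Module.finrank ℝ E) (y : WithLp 2 (E × ℝ)) :
    ‖y‖ ^ 2 = ∑ i, (((Module.finrank ℝ E : ℝ) + 1) / Module.finrank ℝ E * c i) * ⟪liftV u i, y⟫ ^ 2 := by
  have hn' : (0:ℝ) < Module.finrank ℝ E := by exact_mod_cast hn
  have h1 : ∑ i, c i * ⟪u i, y.fst⟫ = 0 := by
    have := frame_shift_sum hu hiso hcent y.fst 0
    simpa using this
  have h2 := frame_total hu hiso
  rw [WithLp.prod_norm_sq_eq_of_L2, hiso y.fst]
  simp only [liftV_inner]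
  set n : ℝ := (Module.finrank ℝ E : ℝ) with hndef
  have e1 : √(n / (n + 1)) ^ 2 = n / (n+1) := Real.sq_sqrt (by positivity)
  have e2 : √(n + 1) ^ 2 = n + 1 := Real.sq_sqrt (by positivity)
  have e2' : (1 / √(n + 1)) ^ 2 = 1 / (n + 1) := by rw [div_pow, e2]; norm_num
  have : ∀ i, (n + 1) / n * c i * (√(n / (n + 1)) * ⟪u i, y.fst⟫ + 1 / √(n + 1) * y.snd) ^ 2 =
      c i * ⟪u i, y.fst⟫ ^ 2 + ((n + 1) / n * 2 * √(n / (n + 1)) * (1 / √(n + 1)) * y.snd) * (c i * ⟪u i, y.fst⟫)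
        + (y.snd ^ 2 / n) * c i := by
    intro i
    have : (√(n / (n + 1)) * ⟪u i, y.fst⟫ + 1 / √(n + 1) * y.snd) ^ 2 =
      √(n / (n + 1)) ^ 2 * ⟪u i, y.fst⟫ ^ 2 + 2 * √(n / (n + 1)) * (1 / √(n + 1)) * y.snd * ⟪u i, y.fst⟫
        + (1 / √(n + 1)) ^ 2 * y.snd ^ 2 := by ring
    rw [this, e1, e2']
    have := Real.sqrt_pos.2 (show 0 < n + 1 by positivity)
    field_simp
  simp only [this, Finset.sum_add_distrib, ← Finset.mul_sum, h1, h2]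
  rw [Real.norm_eq_abs, sq_abs]
  field_simp
  ring

def liftA (u : ι → E) (y : WithLp 2 (E × ℝ)) : ℝ :=
  (gauge (convexHull ℝ (range u)) y.fst / √(Module.finrank ℝ E) - y.snd) / √((Module.finrank ℝ E : ℝ) + 1)

lemma liftA_mem {u : ι → E} {c : ι → ℝ} (hu : ∀ i, ‖u i‖ = 1) (hc : ∀ i, 0 < c i)
    (hiso : ∀ x : E, ‖x‖ ^ 2 = ∑ i, c i * ⟪u i, x⟫ ^ 2) (hcent : ∑ i, c i • u i = 0)
    (hn : 0 < Module.finrank ℝ E) (s : ℝ) (θ : ι → ℝ) (hθ : ∀ i, -s < θ i) :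
    ∑ i, ((((Module.finrank ℝ E : ℝ) + 1) / Module.finrank ℝ E * c i) * θ i) • liftV u i ∈ {y | liftA u y ≤ s} := by
  have hn' : (0:ℝ) < Module.finrank ℝ E := by exact_mod_cast hn
  have h2 := frame_total hu hiso
  simp only [mem_setOf_eq, liftA]
  have hf : (∑ i, ((((Module.finrank ℝ E : ℝ) + 1) / Module.finrank ℝ E * c i) * θ i) • liftV u i).fst =
      ∑ i, ((((Module.finrank ℝ E : ℝ) + 1) / Module.finrank ℝ E * c i) * θ i) • (√((Module.finrank ℝ E : ℝ) / (Module.finrank ℝ E + 1)) • u i) := by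
    have := map_sum (WithLp.fstL 2 ℝ E ℝ) (fun i => ((((Module.finrank ℝ E : ℝ) + 1) / Module.finrank ℝ E * c i) * θ i) • liftV u i) Finset.univ
    exact this.trans (Finset.sum_congr rfl fun i _ => rfl)
  have hs : (∑ i, ((((Module.finrank ℝ E : ℝ) + 1) / Module.finrank ℝ E * c i) * θ i) • liftV u i).snd =
      ∑ i, ((((Module.finrank ℝ E : ℝ) + 1) / Module.finrank ℝ E * c i) * θ i) * (1 / √((Module.finrank ℝ E : ℝ) + 1)) := by
    have := map_sum (WithLp.sndL 2 ℝ E ℝ) (fun i => ((((Module.finrank ℝ E : ℝ) + 1) / Module.finrank ℝ E * c i) * θ i) • liftV u i) Finset.univ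
    exact this.trans (Finset.sum_congr rfl fun i _ => rfl)
  rw [hf, hs]
  set n : ℝ := (Module.finrank ℝ E : ℝ) with hndef
  have hf2 : ∑ i, ((n + 1) / n * c i * θ i) • (√(n / (n + 1)) • u i) =
      ∑ i, ((n + 1) / n * √(n / (n + 1)) * (c i * (θ i + s))) • u i := by
    have : ∑ i, ((n + 1) / n * √(n / (n + 1)) * (c i * (θ i + s))) • u i =
      ∑ i, ((n + 1) / n * c i * θ i) • (√(n / (n + 1)) • u i) + ((n + 1) / n * √(n / (n + 1)) * s) • ∑ i, c i • u i := by
      rw [Finset.smul_sum, ← Finset.sum_add_distrib]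
      refine Finset.sum_congr rfl fun i _ => ?_
      rw [smul_smul, smul_smul, ← add_smul]
      congr 1; ring
    rw [this, hcent]; simp
  rw [hf2]
  have hg := gauge_hull_le (u := u) (a := fun i => (n + 1) / n * √(n / (n + 1)) * (c i * (θ i + s))) (fun i => by
    have := hθ i
    have h3 := (hc i).le
    have : 0 ≤ θ i + s := by linarith
    positivity)
  have hN : 0 < √(n + 1) := Real.sqrt_pos.2 (by positivity)
  have hnn : 0 < √n := Real.sqrt_pos.2 (by positivity)
  have e1 : √n ^ 2 = n := Real.sq_sqrt hn'.le
  have e2 : √(n + 1) ^ 2 = n + 1 := Real.sq_sqrt (by positivity)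
  rw [div_le_iff₀ hN, sub_le_iff_le_add, div_le_iff₀ hnn]
  refine hg.trans (le_of_eq ?_)
  rw [← Finset.mul_sum, Real.sqrt_div hn'.le]
  simp only [mul_add, Finset.sum_add_distrib, ← Finset.sum_mul, h2]
  have e3 : ∑ i, (n + 1) / n * c i * θ i = (n + 1) / n * ∑ i, c i * θ i := by
    rw [Finset.mul_sum]; refine Finset.sum_congr rfl fun i _ => by ring
  rw [e3]
  field_simp
  rw [e2]
  ring

end Lift

section Fub

lemma ind_diff (a b s : ℝ) : (if a ≤ s then (1:ℝ) else 0) - (if b ≤ s then 1 else 0) =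
    (Ico a b).indicator 1 s - (Ico b a).indicator 1 s := by
  simp only [indicator, mem_Ico, Pi.one_apply]
  split_ifs <;> grind

lemma ind_diff_norm (a b s : ℝ) : ‖(if a ≤ s then (1:ℝ) else 0) - (if b ≤ s then 1 else 0)‖ =
    (Ico a b).indicator 1 s + (Ico b a).indicator 1 s := by
  simp only [indicator, mem_Ico, Pi.one_apply]
  split_ifs <;> first | (simp; done) | grind

lemma ind_int (a b : ℝ) : Integrable (fun s => (Ico a b).indicator (1 : ℝ → ℝ) s) := by
  have : Integrable (fun _ : ℝ => (1:ℝ)) (volume.restrict (Ico a b)) := integrable_const _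
  exact (integrable_indicator_iff measurableSet_Ico).2 this

lemma ind_integral (a b : ℝ) : ∫ s, (Ico a b).indicator (1 : ℝ → ℝ) s = max (b - a) 0 := by
  rw [integral_indicator measurableSet_Ico]
  simp [Measure.real, ENNReal.toReal_ofReal_eq_iff, ENNReal.ofReal, Real.coe_toNNReal']

lemma fubini_gap {Ω : Type*} [MeasurableSpace Ω] {μ : Measure Ω} [SigmaFinite μ] {A B p : Ω → ℝ}
    (mA : Measurable A) (mB : Measurable B) (hp : ∀ y, 0 ≤ p y) (ip : Integrable p μ)
    (iA : Integrable (fun y => p y * A y) μ) (iB : Integrable (fun y => p y * B y) μ) {δ : ℝ}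
    (h0 : ∀ s, ∫ y in {y | B y ≤ s}, p y ∂μ ≤ ∫ y in {y | A y ≤ s}, p y ∂μ)
    (h1 : ∀ s, -1 ≤ s → s ≤ 0 → ∫ y in {y | B y ≤ s}, p y ∂μ + δ ≤ ∫ y in {y | A y ≤ s}, p y ∂μ) :
    δ ≤ ∫ y, p y * B y ∂μ - ∫ y, p y * A y ∂μ := by
  set h : Ω → ℝ → ℝ := fun y s => p y * ((if A y ≤ s then (1:ℝ) else 0) - (if B y ≤ s then 1 else 0)) with hh
  have hys : ∀ y, ∫ s, h y s = p y * B y - p y * A y := by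
    intro y
    simp only [hh, ind_diff]
    rw [integral_const_mul, integral_sub (ind_int _ _) (ind_int _ _), ind_integral, ind_integral, ← mul_sub]
    congr 1
    rcases le_total (A y) (B y) with h | h
    · rw [max_eq_left (by linarith), max_eq_right (by linarith)]; ring
    · rw [max_eq_right (by linarith), max_eq_left (by linarith)]; ring
  have hyn : ∀ y, ∫ s, ‖h y s‖ = ‖p y * B y - p y * A y‖ := by
    intro y
    simp only [hh, norm_mul, ind_diff_norm]
    rw [integral_const_mul, integral_add (ind_int _ _) (ind_int _ _), ind_integral, ind_integral, ← mul_sub, norm_mul]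
    congr 1
    rw [Real.norm_eq_abs]
    rcases le_total (A y) (B y) with h | h
    · rw [max_eq_left (by linarith), max_eq_right (by linarith), abs_of_nonneg (by linarith)]; ring
    · rw [max_eq_right (by linarith), max_eq_left (by linarith), abs_of_nonpos (by linarith)]; ring
  have hprod : Integrable (Function.uncurry h) (μ.prod volume) := by
    have hm : AEStronglyMeasurable (Function.uncurry h) (μ.prod volume) := by
      have e : Function.uncurry h = fun z : Ω × ℝ => p z.1 *
        ((if A z.1 ≤ z.2 then (1:ℝ) else 0) - (if B z.1 ≤ z.2 then 1 else 0)) := by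
        ext ⟨y, s⟩; rfl
      rw [e]
      refine (ip.1.comp_fst).mul (Measurable.aestronglyMeasurable ?_)
      refine Measurable.sub ?_ ?_
      · exact Measurable.ite (measurableSet_le (mA.comp measurable_fst) measurable_snd) measurable_const measurable_const
      · exact Measurable.ite (measurableSet_le (mB.comp measurable_fst) measurable_snd) measurable_const measurable_const
    rw [integrable_prod_iff hm]
    constructor
    · refine Filter.Eventually.of_forall fun y => ?_
      simp only [Function.uncurry, hh, ind_diff]
      exact ((ind_int _ _).sub (ind_int _ _)).const_mul _
    · simp only [Function.uncurry, hyn]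
      exact (iB.sub iA).norm
  have hsw := integral_integral_swap hprod
  simp only [hys] at hsw
  rw [integral_sub iB iA] at hsw
  have hs : ∀ s, ∫ y, h y s ∂μ = ∫ y in {y | A y ≤ s}, p y ∂μ - ∫ y in {y | B y ≤ s}, p y ∂μ := by
    intro s
    have mA' : MeasurableSet {y | A y ≤ s} := measurableSet_le mA measurable_const
    have mB' : MeasurableSet {y | B y ≤ s} := measurableSet_le mB measurable_const
    rw [← integral_indicator mA', ← integral_indicator mB', ← integral_sub (ip.indicator mA') (ip.indicator mB')]
    congr 1; ext y
    simp only [hh, indicator, mem_setOf_eq]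
    split_ifs <;> ring
  simp only [hs] at hsw
  rw [hsw]
  have hI : Integrable (fun s => ∫ y in {y | A y ≤ s}, p y ∂μ - ∫ y in {y | B y ≤ s}, p y ∂μ) := by
    have := hprod.integral_prod_right
    simpa only [Function.uncurry, hs] using this
  calc δ = ∫ s in Icc (-1:ℝ) 0, δ := by simp
    _ ≤ ∫ s in Icc (-1:ℝ) 0, (∫ y in {y | A y ≤ s}, p y ∂μ - ∫ y in {y | B y ≤ s}, p y ∂μ) := by
      refine setIntegral_mono_on (by simp) hI.integrableOn measurableSet_Icc fun s hs => ?_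
      have := h1 s hs.1 hs.2
      linarith
    _ ≤ _ := setIntegral_le_integral hI (Filter.Eventually.of_forall fun s => by
      have := h0 s
      simp only [Pi.zero_apply]
      linarith)

end Fub
section Meas
set_option linter.unusedSectionVars false
variable {E : Type*} [NormedAddCommGroup E] [InnerProductSpace ℝ E] [FiniteDimensional ℝ E]
  [MeasurableSpace E] [BorelSpace E]
  {ι : Type*} [Fintype ι]

lemma norm_exp_bound (x : E) : ‖x‖ * Real.exp (-‖x‖ ^ 2 / 2) ≤ Real.exp (-‖x‖ ^ 2 / 4) := by
  have h1 : ‖x‖ ≤ Real.exp (‖x‖ ^ 2 / 4) := by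
    have := Real.add_one_le_exp (‖x‖ ^ 2 / 4)
    nlinarith [sq_nonneg (‖x‖ / 2 - 1)]
  calc _ ≤ Real.exp (‖x‖ ^ 2 / 4) * Real.exp (-‖x‖ ^ 2 / 2) := by gcongr
    _ = _ := by rw [← Real.exp_add]; congr 1; ring

lemma gauss4_integral : ∫ y : E, Real.exp (-‖y‖ ^ 2 / 4) = √(4 * Real.pi) ^ Module.finrank ℝ E := by
  have := integral_onb_prod (stdOrthonormalBasis ℝ E) (fun t => Real.exp (-t ^ 2 / 4))
  have h2 : ∫ t : ℝ, Real.exp (-t ^ 2 / 4) = √(4 * Real.pi) := by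
    have := integral_gaussian (1/4)
    rw [show Real.pi / (1/4) = 4 * Real.pi by ring] at this
    rw [← this]
    congr 1; ext t; congr 1; ring
  rw [h2, Fintype.card_fin] at this
  rw [← this]
  congr 1; ext y
  rw [← Real.exp_sum, ← Finset.sum_div, Finset.sum_neg_distrib,
    (stdOrthonormalBasis ℝ E).sum_sq_inner_right]

lemma gauss4_integrable : Integrable (fun y : E => Real.exp (-‖y‖ ^ 2 / 4)) := by
  by_contra h
  have := integral_undef h
  rw [gauss4_integral] at this
  have h2 : 0 < √(4 * Real.pi) ^ Module.finrank ℝ E := by positivity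
  linarith

lemma norm_gauss_integrable : Integrable (fun x : E => ‖x‖ * Real.exp (-‖x‖ ^ 2 / 2)) := by
  refine gauss4_integrable.mono' (Continuous.aestronglyMeasurable (by fun_prop)) (Filter.Eventually.of_forall fun x => ?_)
  rw [Real.norm_eq_abs, abs_of_nonneg (by positivity)]
  exact norm_exp_bound x

lemma norm_gauss_le : ∫ x : E, ‖x‖ * Real.exp (-‖x‖ ^ 2 / 2) ≤ √(4 * Real.pi) ^ Module.finrank ℝ E := by
  rw [← gauss4_integral]
  exact integral_mono norm_gauss_integrable gauss4_integrable norm_exp_bound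

lemma lift_integral (g : E → ℝ) (hg : Continuous g) {M : ℝ} (hM : ∀ x, |g x| ≤ M * ‖x‖) (a b : ℝ) :
    Integrable (fun y : WithLp 2 (E × ℝ) => Real.exp (-‖y‖ ^ 2 / 2) * ((g y.fst / a - y.snd) / b)) ∧
    ∫ y : WithLp 2 (E × ℝ), Real.exp (-‖y‖ ^ 2 / 2) * ((g y.fst / a - y.snd) / b) =
      √(2 * Real.pi) / (a * b) * ∫ x : E, g x * Real.exp (-‖x‖ ^ 2 / 2) := by
  have hmp := WithLp.volume_preserving_ofLp E ℝ
  have hemb : MeasurableEmbedding (WithLp.ofLp : WithLp 2 (E × ℝ) → E × ℝ) :=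
    (MeasurableEquiv.toLp 2 (E × ℝ)).symm.measurableEmbedding
  set G : E × ℝ → ℝ := fun z => (g z.1 * Real.exp (-‖z.1‖ ^ 2 / 2)) * Real.exp (-z.2 ^ 2 / 2) / (a * b) -
    Real.exp (-‖z.1‖ ^ 2 / 2) * (z.2 * Real.exp (-z.2 ^ 2 / 2)) / b with hG
  have hfun : (fun y : WithLp 2 (E × ℝ) => Real.exp (-‖y‖ ^ 2 / 2) * ((g y.fst / a - y.snd) / b)) =
      fun y => G (WithLp.ofLp y) := by
    ext y
    have e : Real.exp (-‖y‖ ^ 2 / 2) = Real.exp (-‖y.fst‖ ^ 2 / 2) * Real.exp (-y.snd ^ 2 / 2) := by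
      rw [← Real.exp_add, WithLp.prod_norm_sq_eq_of_L2, Real.norm_eq_abs, sq_abs]
      congr 1; ring
    rw [e]
    simp only [hG, WithLp.fst, WithLp.snd]
    by_cases ha : a = 0
    · simp [ha]; ring
    by_cases hb : b = 0
    · simp [hb]
    field_simp
  have ig : Integrable (fun x : E => g x * Real.exp (-‖x‖ ^ 2 / 2)) := by
    refine (norm_gauss_integrable.const_mul M).mono' (Continuous.aestronglyMeasurable (by fun_prop)) (Filter.Eventually.of_forall fun x => ?_)
    rw [Real.norm_eq_abs, abs_mul, abs_of_pos (Real.exp_pos _), ← mul_assoc]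
    exact mul_le_mul_of_nonneg_right (hM x) (Real.exp_pos _).le
  have ir : Integrable (fun r : ℝ => r * Real.exp (-r ^ 2 / 2)) := by
    refine (norm_gauss_integrable (E := ℝ)).mono' (Continuous.aestronglyMeasurable (by fun_prop)) (Filter.Eventually.of_forall fun x => ?_)
    simp
  have hr0 : ∫ r : ℝ, r * Real.exp (-r ^ 2 / 2) = 0 := by
    have := integral_neg_eq_self (fun r : ℝ => r * Real.exp (-r ^ 2 / 2)) volume
    simp only [neg_sq, neg_mul] at this
    rw [integral_neg] at this
    linarith
  have i1 : Integrable (fun z : E × ℝ => (g z.1 * Real.exp (-‖z.1‖ ^ 2 / 2)) * Real.exp (-z.2 ^ 2 / 2)) :=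
    ig.mul_prod gexp_integrable
  have i2 : Integrable (fun z : E × ℝ => Real.exp (-‖z.1‖ ^ 2 / 2) * (z.2 * Real.exp (-z.2 ^ 2 / 2))) :=
    gauss_integrable.mul_prod ir
  have iG : Integrable G := (i1.div_const _).sub (i2.div_const _)
  rw [hfun]
  refine ⟨(hmp.integrable_comp_emb hemb).2 iG, ?_⟩
  rw [hmp.integral_comp hemb G, hG, integral_sub (i1.div_const _) (i2.div_const _), integral_div, integral_div]
  have e1 : ∫ z : E × ℝ, (g z.1 * Real.exp (-‖z.1‖ ^ 2 / 2)) * Real.exp (-z.2 ^ 2 / 2) = _ :=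
    integral_prod_mul (fun x : E => g x * Real.exp (-‖x‖ ^ 2 / 2)) (fun r : ℝ => Real.exp (-r ^ 2 / 2))
  have e2 : ∫ z : E × ℝ, Real.exp (-‖z.1‖ ^ 2 / 2) * (z.2 * Real.exp (-z.2 ^ 2 / 2)) = _ :=
    integral_prod_mul (fun x : E => Real.exp (-‖x‖ ^ 2 / 2)) (fun r : ℝ => r * Real.exp (-r ^ 2 / 2))
  rw [e1, e2, hr0, gexp_integral]
  ring

end Meas

section Reg
set_option linter.unusedSectionVars false
variable {E : Type*} [NormedAddCommGroup E] [InnerProductSpace ℝ E] [FiniteDimensional ℝ E]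
  {κ : Type*} [Fintype κ]

lemma reg_onb {w : κ → E} (hw1 : ∀ i, ‖w i‖ = 1) (hw2 : ∀ i j, i ≠ j → ⟪w i, w j⟫ = -1 / (Module.finrank ℝ E : ℝ))
    (hcard : Fintype.card κ = Module.finrank ℝ E + 1) (hn : 0 < Module.finrank ℝ E) :
    ∃ b : OrthonormalBasis κ ℝ (WithLp 2 (E × ℝ)), ∀ j, b j = liftV w j := by
  classical
  have hn' : (0:ℝ) < Module.finrank ℝ E := by exact_mod_cast hn
  have hon : Orthonormal ℝ (liftV w) := by
    refine ⟨liftV_norm hw1, fun i j hij => ?_⟩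
    show ⟪liftV w i, liftV w j⟫ = 0
    rw [liftV_inner_liftV, hw2 i j hij]
    field_simp
    simp
  have : Nonempty κ := Fintype.card_pos_iff.1 (by omega)
  have hsp := hon.linearIndependent.span_eq_top_of_card_eq_finrank' (by rw [hcard, lift_finrank])
  exact ⟨OrthonormalBasis.mk hon hsp.ge, fun j => by simp⟩

lemma reg_frame {w : κ → E} (hw1 : ∀ i, ‖w i‖ = 1) (hw2 : ∀ i j, i ≠ j → ⟪w i, w j⟫ = -1 / (Module.finrank ℝ E : ℝ))
    (hcard : Fintype.card κ = Module.finrank ℝ E + 1) (hn : 0 < Module.finrank ℝ E) (x : E) :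
    ‖x‖ ^ 2 = ∑ i, ((Module.finrank ℝ E : ℝ) / (Module.finrank ℝ E + 1)) * ⟪w i, x⟫ ^ 2 := by
  obtain ⟨b, hb⟩ := reg_onb hw1 hw2 hcard hn
  have h := b.sum_sq_inner_right (WithLp.toLp 2 (x, (0:ℝ)))
  simp only [hb, liftV_inner] at h
  change ∑ i, (_ * ⟪w i, x⟫ + _ * (0:ℝ)) ^ 2 = _ at h
  simp only [mul_zero, add_zero, mul_pow] at h
  rw [Real.sq_sqrt (by positivity), WithLp.prod_norm_sq_eq_of_L2] at h
  simpa using h.symm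

lemma reg_cent {w : κ → E} (hw1 : ∀ i, ‖w i‖ = 1) (hw2 : ∀ i j, i ≠ j → ⟪w i, w j⟫ = -1 / (Module.finrank ℝ E : ℝ))
    (hcard : Fintype.card κ = Module.finrank ℝ E + 1) (hn : 0 < Module.finrank ℝ E) :
    ∑ i, w i = 0 := by
  classical
  have hn' : (0:ℝ) < Module.finrank ℝ E := by exact_mod_cast hn
  have h : ∀ i, ∑ j, ⟪w i, w j⟫ = 0 := by
    intro i
    rw [← Finset.add_sum_erase _ _ (Finset.mem_univ i), real_inner_self_eq_norm_sq, hw1,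
      Finset.sum_congr rfl (fun j hj => hw2 i j (Finset.ne_of_mem_erase hj).symm), Finset.sum_const,
      Finset.card_erase_of_mem (Finset.mem_univ i), Finset.card_univ, hcard]
    simp
    field_simp
    simp
  have : ‖∑ i, w i‖ ^ 2 = 0 := by
    rw [← real_inner_self_eq_norm_sq, sum_inner]
    simp only [inner_sum, h]
    simp
  simpa using this

variable [MeasurableSpace E] [BorelSpace E]  {ι : Type*} [Fintype ι]

lemma reg_measure {w : κ → E} (hw1 : ∀ i, ‖w i‖ = 1) (hw2 : ∀ i j, i ≠ j → ⟪w i, w j⟫ = -1 / (Module.finrank ℝ E : ℝ))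
    (hcard : Fintype.card κ = Module.finrank ℝ E + 1) (hn : 0 < Module.finrank ℝ E) (s : ℝ) :
    ∫ y in {y | liftA w y ≤ s}, Real.exp (-‖y‖ ^ 2 / 2) ≤ gtail (-s) ^ (Module.finrank ℝ E + 1) := by
  classical
  have hn' : (0:ℝ) < Module.finrank ℝ E := by exact_mod_cast hn
  obtain ⟨b, hb⟩ := reg_onb hw1 hw2 hcard hn
  have hcent := reg_cent hw1 hw2 hcard hn
  have hnh := hull_nhds hw1 (c := fun _ => (Module.finrank ℝ E : ℝ) / (Module.finrank ℝ E + 1))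
    (fun _ => by positivity) (reg_frame hw1 hw2 hcard hn) (by rw [← Finset.smul_sum, hcent, smul_zero]) hn
  have hI := integral_onb_prod b ((Ici (-s)).indicator fun t => Real.exp (-t ^ 2 / 2))
  rw [integral_indicator measurableSet_Ici, integral_Ici_eq_integral_Ioi, hcard] at hI
  change _ = gtail (-s) ^ _ at hI
  rw [← hI]
  set T : Set (WithLp 2 (E × ℝ)) := {y | ∀ j, -s ≤ ⟪b j, y⟫} with hT
  have mT : MeasurableSet T := by
    rw [hT, setOf_forall]
    refine MeasurableSet.iInter fun j => ?_
    exact (isClosed_le continuous_const (by fun_prop)).measurableSet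
  have hprod : (fun y => ∏ j, (Ici (-s)).indicator (fun t => Real.exp (-t ^ 2 / 2)) ⟪b j, y⟫) =
      T.indicator fun y => Real.exp (-‖y‖ ^ 2 / 2) := by
    ext y
    by_cases hy : y ∈ T
    · rw [indicator_of_mem hy, Finset.prod_congr rfl fun j _ => indicator_of_mem (show ⟪b j, y⟫ ∈ Ici (-s) from hy j) _, ← Real.exp_sum,
        ← Finset.sum_div, Finset.sum_neg_distrib, b.sum_sq_inner_right]
    · rw [indicator_of_notMem hy]
      simp only [hT, mem_setOf_eq, not_forall] at hy
      obtain ⟨j, hj⟩ := hy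
      exact Finset.prod_eq_zero (Finset.mem_univ j) (indicator_of_notMem hj _)
  rw [hprod, integral_indicator mT]
  refine setIntegral_mono_set gauss_integrable.integrableOn
      (Filter.Eventually.of_forall fun _ => (Real.exp_pos _).le) (Filter.Eventually.of_forall fun y hy j => ?_)
  have hy' : liftA w y ≤ s := hy
  have hg := gauge_hull_ge hnh (-(Module.finrank ℝ E : ℝ) • w j) (fun i => by
    rw [inner_smul_left]
    by_cases hij : j = i
    · subst hij
      rw [real_inner_self_eq_norm_sq, hw1]
      simp
      linarith
    · rw [hw2 j i hij]
      simp
      field_simp; simp) y.fst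
  rw [inner_smul_left] at hg
  simp only [map_neg, conj_trivial] at hg
  rw [hb, liftV_inner]
  rw [liftA] at hy'
  set n : ℝ := (Module.finrank ℝ E : ℝ)
  have hN : 0 < √(n + 1) := Real.sqrt_pos.2 (by positivity)
  have hnn : 0 < √n := Real.sqrt_pos.2 (by positivity)
  have e1 : √n ^ 2 = n := Real.sq_sqrt hn'.le
  rw [Real.sqrt_div hn'.le]
  have h2 : -(√n / √(n + 1) * ⟪w j, y.fst⟫ + 1 / √(n + 1) * y.snd) ≤
     (gauge (convexHull ℝ (range w)) y.fst / √n - y.snd) / √(n + 1) := by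
    rw [le_div_iff₀ hN, le_sub_iff_add_le, le_div_iff₀ hnn]
    refine le_trans (le_of_eq ?_) hg
    field_simp
    linear_combination (-⟪w j, y.fst⟫) * e1
  linarith

lemma ell_gap {u : ι → E} {c : ι → ℝ} (hu : ∀ i, ‖u i‖ = 1) (hc : ∀ i, 0 < c i)
    (hiso : ∀ x : E, ‖x‖ ^ 2 = ∑ i, c i * ⟪u i, x⟫ ^ 2) (hcent : ∑ i, c i • u i = 0)
    {w : κ → E} (hw1 : ∀ i, ‖w i‖ = 1) (hw2 : ∀ i j, i ≠ j → ⟪w i, w j⟫ = -1 / (Module.finrank ℝ E : ℝ))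
    (hcard : Fintype.card κ = Module.finrank ℝ E + 1) (hn : 0 < Module.finrank ℝ E)
    {K : ℝ} (hK : 1 ≤ K) {i j : ι} (hij : i ≠ j)
    (hi : 1 / K ≤ ((Module.finrank ℝ E : ℝ) + 1) / Module.finrank ℝ E * c i)
    (hj : 1 / K ≤ ((Module.finrank ℝ E : ℝ) + 1) / Module.finrank ℝ E * c j)
    (hρ : ⟪liftV u i, liftV u j⟫ ^ 2 ≤ 1 - 1 / K) :
    (1 / 20) ^ (Module.finrank ℝ E + 1 + 2) * (⟪liftV u i, liftV u j⟫ ^ 2 *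
        (1 / (128 * 12 ^ 4 * K ^ 5)) * ((1 / (48 * K) / (Module.finrank ℝ E + 1 : ℕ)) ^ (Module.finrank ℝ E + 1) / 2))
      ≤ √(2 * Real.pi) / (√(Module.finrank ℝ E) * √((Module.finrank ℝ E : ℝ) + 1)) *
        ((∫ x : E, gauge (convexHull ℝ (range w)) x * Real.exp (-‖x‖ ^ 2 / 2)) -
          ∫ x : E, gauge (convexHull ℝ (range u)) x * Real.exp (-‖x‖ ^ 2 / 2)) := by
  have hn' : (0:ℝ) < Module.finrank ℝ E := by exact_mod_cast hn
  have hwc : ∑ i, ((Module.finrank ℝ E : ℝ) / (Module.finrank ℝ E + 1)) • w i = 0 := by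
    rw [← Finset.smul_sum, reg_cent hw1 hw2 hcard hn, smul_zero]
  have hwf := reg_frame hw1 hw2 hcard hn
  have hc0 : ∀ _ : κ, 0 < (Module.finrank ℝ E : ℝ) / (Module.finrank ℝ E + 1) := fun _ => by positivity
  have nw := hull_nhds hw1 hc0 hwf hwc hn
  have nu := hull_nhds hu hc hiso hcent hn
  have cw := continuous_gauge (convex_convexHull ℝ (range w)) nw
  have cu := continuous_gauge (convex_convexHull ℝ (range u)) nu
  obtain ⟨iw, ew⟩ := lift_integral (gauge (convexHull ℝ (range w))) cw (M := Module.finrank ℝ E)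
    (fun x => by rw [abs_of_nonneg (gauge_nonneg _)]; exact gauge_hull_le_norm hw1 hc0 hwf hwc x)
    (√(Module.finrank ℝ E)) (√((Module.finrank ℝ E : ℝ) + 1))
  obtain ⟨iu, eu⟩ := lift_integral (gauge (convexHull ℝ (range u))) cu (M := Module.finrank ℝ E)
    (fun x => by rw [abs_of_nonneg (gauge_nonneg _)]; exact gauge_hull_le_norm hu hc hiso hcent x)
    (√(Module.finrank ℝ E)) (√((Module.finrank ℝ E : ℝ) + 1))
  rw [mul_sub, ← ew, ← eu]
  have hC : ∀ i, 0 < ((Module.finrank ℝ E : ℝ) + 1) / Module.finrank ℝ E * c i := fun i => by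
    have := hc i
    positivity
  have hfst : Continuous (fun y : WithLp 2 (E × ℝ) => y.fst) := (WithLp.fstL 2 ℝ E ℝ).continuous
  have hsnd : Continuous (fun y : WithLp 2 (E × ℝ) => y.snd) := (WithLp.sndL 2 ℝ E ℝ).continuous
  have mu : Continuous (liftA u) := (((cu.comp hfst).div_const _).sub hsnd).div_const _
  have mw : Continuous (liftA w) := (((cw.comp hfst).div_const _).sub hsnd).div_const _
  refine fubini_gap (p := fun y : WithLp 2 (E × ℝ) => Real.exp (-‖y‖ ^ 2 / 2))
    mu.measurable mw.measurable (fun y => (Real.exp_pos _).le) gauss_integrable iu iw ?_ ?_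
  · intro s
    refine (reg_measure hw1 hw2 hcard hn s).trans ?_
    have := transport_basic (liftV_norm hu) hC (lift_frame hu hiso hcent hn) s {y | liftA u y ≤ s}
      (liftA_mem hu hc hiso hcent hn s)
    rwa [lift_finrank] at this
  · intro s hs1 hs2
    have := transport_pair (liftV_norm hu) hC (lift_frame hu hiso hcent hn) hs1 hs2 {y | liftA u y ≤ s}
      (liftA_mem hu hc hiso hcent hn s) hK hij hi hj hρ
    rw [lift_finrank] at this
    have h2 := reg_measure hw1 hw2 hcard hn s
    linarith

end Reg

lemma ellNorm_eq (n : ℕ) (K : Set (EuclideanSpace ℝ (Fin n))) :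
    ellNorm n K = (2 * Real.pi) ^ (-(n : ℝ) / 2) * ∫ x, gauge K x * Real.exp (-‖x‖ ^ 2 / 2) := by
  unfold ellNorm gaussianM
  rw [integral_withDensity_eq_integral_toReal_smul (by fun_prop) (by simp), ← integral_const_mul]
  congr 1; ext x
  rw [ENNReal.toReal_ofReal (by positivity), smul_eq_mul]
  ring

lemma const_bound (n : ℕ) (hn : 2 ≤ n) {r ε : ℝ} (hε : 0 ≤ ε)
    (h : (1 / 20) ^ (n + 1 + 2) * (r * (1 / (128 * 12 ^ 4 * (2 * (n:ℝ) ^ 2) ^ 5)) *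
      ((1 / (48 * (2 * (n:ℝ) ^ 2)) / (n + 1 : ℕ)) ^ (n + 1) / 2)) ≤ (18 / 5) ^ (n + 1) * ε) :
    r ≤ (n:ℝ) ^ (50 * n) * ε := by
  have hn2 : (2:ℝ) ≤ n := by exact_mod_cast hn
  have hn0 : (0:ℝ) < n := by linarith
  set D : ℝ := 20 ^ (n + 1 + 2) * (128 * 12 ^ 4 * (2 * (n:ℝ) ^ 2) ^ 5) * ((48 * (2 * (n:ℝ) ^ 2) * (n + 1 : ℕ)) ^ (n + 1) * 2) with hD
  have hD0 : 0 < D := by positivity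
  have e : (1 / 20) ^ (n + 1 + 2) * (r * (1 / (128 * 12 ^ 4 * (2 * (n:ℝ) ^ 2) ^ 5)) *
      ((1 / (48 * (2 * (n:ℝ) ^ 2)) / (n + 1 : ℕ)) ^ (n + 1) / 2)) = r / D := by
    rw [div_div, div_pow, div_pow, one_pow, one_pow, hD]
    field_simp
  rw [e, div_le_iff₀ hD0] at h
  refine h.trans ?_
  rw [mul_right_comm]
  refine mul_le_mul_of_nonneg_right ?_ hε
  have e2 : (18 / 5) ^ (n + 1) * D = (6912 * (n:ℝ) ^ 2 * (n + 1 : ℕ)) ^ (n + 1) * (67947724800 * (n:ℝ) ^ 10) := by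
    rw [hD, show 6912 * (n:ℝ) ^ 2 * (n + 1 : ℕ) = (18 / 5) * (20 * (48 * (2 * (n:ℝ) ^ 2) * (n + 1 : ℕ))) by ring,
      mul_pow (18 / 5 : ℝ), mul_pow (20 : ℝ), pow_add 20 (n+1) 2]
    ring
  rw [e2]
  have h14 : (2:ℝ) ^ 14 ≤ (n:ℝ) ^ 14 := pow_le_pow_left₀ (by norm_num) hn2 _
  have h36 : (2:ℝ) ^ 36 ≤ (n:ℝ) ^ 36 := pow_le_pow_left₀ (by norm_num) hn2 _
  have a1 : 6912 * (n:ℝ) ^ 2 * (n + 1 : ℕ) ≤ (n:ℝ) ^ 17 := by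
    have : ((n + 1 : ℕ) : ℝ) ≤ 3 / 2 * n := by push_cast; linarith
    calc _ ≤ 6912 * (n:ℝ) ^ 2 * (3 / 2 * n) := by gcongr
      _ = 10368 * (n:ℝ) ^ 3 := by ring
      _ ≤ (n:ℝ) ^ 14 * (n:ℝ) ^ 3 := by gcongr; linarith
      _ = _ := by ring
  have a2 : 67947724800 * (n:ℝ) ^ 10 ≤ (n:ℝ) ^ 46 := by
    calc _ ≤ (n:ℝ) ^ 36 * (n:ℝ) ^ 10 := by gcongr; linarith
      _ = _ := by ring
  calc _ ≤ ((n:ℝ) ^ 17) ^ (n + 1) * (n:ℝ) ^ 46 := by gcongr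
    _ = (n:ℝ) ^ (17 * (n + 1) + 46) := by rw [← pow_mul, ← pow_add]
    _ ≤ _ := pow_le_pow_right₀ (by linarith) (by omega)

lemma rho_bound (n k : ℕ) (hn : 2 ≤ n) 
    (u : Fin k → EuclideanSpace ℝ (Fin n)) (hu : ∀ i, ‖u i‖ = 1)
    (c : Fin k → ℝ) (hc : ∀ i, 0 < c i)
    (hiso : ∀ x : EuclideanSpace ℝ (Fin n), ‖x‖ ^ 2 = ∑ i, c i * ⟪u i, x⟫ ^ 2)
    (hcent : ∑ i, c i • u i = 0)
    (w₀ : Fin (n + 1) → EuclideanSpace ℝ (Fin n)) (hw₀ : IsRegVerts w₀)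
    (ε : ℝ) (hε0 : 0 < ε) 
    (hℓ : (1 - ε) * ellNorm n (convexHull ℝ (Set.range w₀)) ≤
      ellNorm n (convexHull ℝ (Set.range u)))
    {i j : Fin k} (hij : i ≠ j)
    (hi : 1 / (2 * (n:ℝ) ^ 2) ≤ ((n : ℝ) + 1) / n * c i)
    (hj : 1 / (2 * (n:ℝ) ^ 2) ≤ ((n : ℝ) + 1) / n * c j)
    (hρ : ⟪liftV u i, liftV u j⟫ ^ 2 ≤ 1 - 1 / (2 * (n:ℝ) ^ 2)) :
    ⟪liftV u i, liftV u j⟫ ^ 2 ≤ (n:ℝ) ^ (50 * n) * ε := by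
  have hn2 : (2:ℝ) ≤ n := by exact_mod_cast hn
  have hn0 : (0:ℝ) < n := by linarith
  have hfin : Module.finrank ℝ (EuclideanSpace ℝ (Fin n)) = n := finrank_euclideanSpace_fin
  obtain ⟨hw1, hw2⟩ := hw₀
  have hw2' : ∀ i j, i ≠ j → ⟪w₀ i, w₀ j⟫ = -1 / (Module.finrank ℝ (EuclideanSpace ℝ (Fin n)) : ℝ) := by
    rw [hfin]; exact hw2
  have hcard : Fintype.card (Fin (n+1)) = Module.finrank ℝ (EuclideanSpace ℝ (Fin n)) + 1 := by
    rw [hfin]; simp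
  have hpos : 0 < Module.finrank ℝ (EuclideanSpace ℝ (Fin n)) := by rw [hfin]; omega
  have hgap := ell_gap hu hc hiso hcent hw1 hw2' hcard hpos (K := 2 * (n:ℝ) ^ 2) (by nlinarith) hij
    (by rw [hfin]; exact hi) (by rw [hfin]; exact hj) hρ
  rw [hfin] at hgap
  refine const_bound n hn hε0.le (hgap.trans ?_)
  have hIw : ∫ x, gauge (convexHull ℝ (range w₀)) x * Real.exp (-‖x‖ ^ 2 / 2) ≤ n * √(4 * Real.pi) ^ n := by
    have hb : ∀ x, gauge (convexHull ℝ (range w₀)) x ≤ n * ‖x‖ := by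
      intro x
      have := gauge_hull_le_norm hw1 (c := fun _ => (n:ℝ) / (n + 1)) (fun _ => by positivity)
        (fun y => by have := reg_frame hw1 hw2' hcard hpos y; rwa [hfin] at this)
        (by rw [← Finset.smul_sum, reg_cent hw1 hw2' hcard hpos, smul_zero]) x
      rwa [hfin] at this
    have h1 : ∫ x, gauge (convexHull ℝ (range w₀)) x * Real.exp (-‖x‖ ^ 2 / 2) ≤
        ∫ x : EuclideanSpace ℝ (Fin n), (n:ℝ) * (‖x‖ * Real.exp (-‖x‖ ^ 2 / 2)) := by
      refine integral_mono_of_nonneg (Filter.Eventually.of_forall fun x => mul_nonneg (gauge_nonneg _) (Real.exp_pos _).le)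
        (norm_gauss_integrable.const_mul _) (Filter.Eventually.of_forall fun x => ?_)
      simp only [← mul_assoc]
      exact mul_le_mul_of_nonneg_right (hb x) (Real.exp_pos _).le
    rw [integral_const_mul] at h1
    have h2 := norm_gauss_le (E := EuclideanSpace ℝ (Fin n))
    rw [hfin] at h2
    exact h1.trans (by gcongr)
  rw [ellNorm_eq, ellNorm_eq] at hℓ
  have hpp : 0 < (2 * Real.pi) ^ (-(n : ℝ) / 2) := by positivity
  set Iw := ∫ x, gauge (convexHull ℝ (range w₀)) x * Real.exp (-‖x‖ ^ 2 / 2)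
  set Iu := ∫ x, gauge (convexHull ℝ (range u)) x * Real.exp (-‖x‖ ^ 2 / 2)
  have hd : Iw - Iu ≤ ε * Iw := by
    have : (2 * Real.pi) ^ (-(n : ℝ) / 2) * ((1 - ε) * Iw) ≤ (2 * Real.pi) ^ (-(n : ℝ) / 2) * Iu := by linarith
    have := le_of_mul_le_mul_left this hpp
    linarith
  have hd2 : Iw - Iu ≤ ε * (n * √(4 * Real.pi) ^ n) := hd.trans (by gcongr)
  have hpi := Real.pi_lt_d2
  have s1 : √(2 * Real.pi) ≤ 18 / 5 := Real.sqrt_le_iff.2 ⟨by norm_num, by linarith⟩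
  have s2 : √(4 * Real.pi) ≤ 18 / 5 := Real.sqrt_le_iff.2 ⟨by norm_num, by linarith⟩
  have hnN : (n:ℝ) ≤ √n * √((n:ℝ) + 1) := by
    rw [← Real.sqrt_mul hn0.le]
    apply Real.le_sqrt_of_sq_le
    nlinarith
  have hq : 0 < √n * √((n:ℝ) + 1) := by positivity
  calc _ ≤ √(2 * Real.pi) / (√n * √((n:ℝ) + 1)) * (ε * (n * √(4 * Real.pi) ^ n)) := by gcongr
    _ = √(2 * Real.pi) * √(4 * Real.pi) ^ n * ε * (n / (√n * √((n:ℝ) + 1))) := by ring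
    _ ≤ √(2 * Real.pi) * √(4 * Real.pi) ^ n * ε * 1 := by
      gcongr
      exact (div_le_one hq).2 hnN
    _ ≤ (18 / 5) * (18 / 5) ^ n * ε * 1 := by gcongr
    _ = _ := by ring

section Greedy
set_option linter.unusedSectionVars false
variable {F : Type*} [NormedAddCommGroup F] [InnerProductSpace ℝ F] [FiniteDimensional ℝ F]

lemma bessel_pair {x a e : F} (hx : ‖x‖ = 1) (ha : ‖a‖ = 1) (he : ‖e‖ = 1) (hae : ⟪a, e⟫ = 0) :
    ⟪x, a⟫ ^ 2 + ⟪x, e⟫ ^ 2 ≤ 1 := by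
  have h : 0 ≤ ‖x - (⟪x, a⟫ • a + ⟪x, e⟫ • e)‖ ^ 2 := by positivity
  have h2 : ‖⟪x, a⟫ • a + ⟪x, e⟫ • e‖ ^ 2 = ⟪x, a⟫ ^ 2 + ⟪x, e⟫ ^ 2 := by
    rw [norm_add_sq_real, norm_smul, norm_smul, ha, he, inner_smul_left, inner_smul_right, hae]
    simp
  rw [norm_sub_sq_real, h2, inner_add_right, inner_smul_right, inner_smul_right, hx] at h
  nlinarith

lemma greedy {k : ℕ} {v : Fin k → F} {C : Fin k → ℝ} (hv : ∀ i, ‖v i‖ = 1) (hC : ∀ i, 0 < C i)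
    (hiso : ∀ y, ‖y‖ ^ 2 = ∑ i, C i * ⟪v i, y⟫ ^ 2) {K : ℝ} (hK0 : 0 < K) (hK : (k:ℝ) ≤ K) (m : ℕ)
    (hm : m ≤ Module.finrank ℝ F) :
    ∃ idx : Fin m → Fin k, (∀ a, 1 / K ≤ C (idx a)) ∧
      ∀ a b, a ≠ b → ⟪v (idx a), v (idx b)⟫ ^ 2 ≤ 1 - 1 / K := by
  induction m with
  | zero => exact ⟨fun a => a.elim0, fun a => a.elim0, fun a => a.elim0⟩
  | succ m ih =>
    obtain ⟨idx, h1, h2⟩ := ih (by omega)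
    set W := Submodule.span ℝ (range fun a => v (idx a)) with hW
    have hWr : Module.finrank ℝ W ≤ m := by
      have := finrank_range_le_card (R := ℝ) (fun a => v (idx a))
      rwa [Set.finrank, Fintype.card_fin] at this
    have hWn : Wᗮ ≠ ⊥ := by
      intro h
      have := Submodule.finrank_add_finrank_orthogonal W
      rw [h, finrank_bot] at this
      omega
    obtain ⟨e0, he0, hne⟩ := Submodule.exists_mem_ne_zero_of_ne_bot hWn
    set e := ‖e0‖⁻¹ • e0 with he
    have hen : ‖e‖ = 1 := by
      rw [he, norm_smul, norm_inv, norm_norm, inv_mul_cancel₀ (norm_ne_zero_iff.2 hne)]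
    have heW : e ∈ Wᗮ := Submodule.smul_mem _ _ he0
    have hperp : ∀ a, ⟪v (idx a), e⟫ = 0 := fun a =>
      Submodule.inner_right_of_mem_orthogonal (Submodule.subset_span (mem_range_self a)) heW
    have hsum := hiso e
    rw [hen, one_pow] at hsum
    obtain ⟨i, hi⟩ : ∃ i, 1 / K ≤ C i * ⟪v i, e⟫ ^ 2 := by
      by_contra hcon
      push Not at hcon
      rcases Nat.eq_zero_or_pos k with hk | hk
      · subst hk; simp at hsum
      have : Nonempty (Fin k) := ⟨⟨0, hk⟩⟩
      have h3 : ∑ i, C i * ⟪v i, e⟫ ^ 2 < ∑ i : Fin k, 1 / K :=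
        Finset.sum_lt_sum_of_nonempty Finset.univ_nonempty fun i _ => hcon i
      rw [← hsum] at h3
      simp only [Finset.sum_const, Finset.card_univ, Fintype.card_fin, nsmul_eq_mul] at h3
      have : (k:ℝ) * (1 / K) ≤ 1 := by rw [mul_one_div]; exact (div_le_one hK0).2 hK
      linarith
    have hC1 := frame_le_one hv hC hiso i
    have hCi := hC i
    have hin1 : ⟪v i, e⟫ ^ 2 ≤ 1 := by
      rw [sq_le_one_iff_abs_le_one]
      have := abs_real_inner_le_norm (v i) e
      rwa [hv, hen, one_mul] at this
    have hin : 1 / K ≤ ⟪v i, e⟫ ^ 2 := by nlinarith [sq_nonneg ⟪v i, e⟫]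
    have hb : ∀ a, ⟪v i, v (idx a)⟫ ^ 2 ≤ 1 - 1 / K := fun a => by
      have := bessel_pair (hv i) (hv (idx a)) hen (hperp a)
      linarith
    refine ⟨Fin.cons i idx, ?_, ?_⟩
    · intro a
      refine Fin.cases ?_ (fun a => ?_) a
      · simp only [Fin.cons_zero]; nlinarith
      · simp only [Fin.cons_succ]; exact h1 a
    · intro a b
      refine Fin.cases ?_ (fun a => ?_) a <;> refine Fin.cases ?_ (fun b => ?_) b
      · simp
      · intro _; simp only [Fin.cons_zero, Fin.cons_succ]; exact hb b
      · intro _; simp only [Fin.cons_zero, Fin.cons_succ]; rw [real_inner_comm]; exact hb a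
      · intro hab; simp only [Fin.cons_succ]; exact h2 a b (fun h => hab (by rw [h]))

end Greedy

section Round
set_option linter.unusedSectionVars false
variable {E : Type*} [NormedAddCommGroup E] [InnerProductSpace ℝ E] [FiniteDimensional ℝ E]
  {κ : Type*} [Fintype κ]

lemma near_iso (A : E →ₗ[ℝ] E) {t : ℝ} (ht0 : 0 ≤ t) (ht : t < 1)
    (hA : ∀ x, |‖A x‖ ^ 2 - ‖x‖ ^ 2| ≤ t * ‖x‖ ^ 2) :
    ∃ Q : E ≃ₗᵢ[ℝ] E, ∀ x, ‖A x - Q x‖ ≤ t * ‖x‖ := by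
  classical
  have hT : (A.adjoint ∘ₗ A).IsSymmetric := by
    intro x y
    simp [LinearMap.adjoint_inner_left, LinearMap.adjoint_inner_right]
  set b := hT.eigenvectorBasis rfl with hb
  set μ := hT.eigenvalues rfl with hμ
  have hTb : ∀ i x, ⟪A (b i), A x⟫ = μ i * ⟪b i, x⟫ := by
    intro i x
    rw [← LinearMap.adjoint_inner_left]
    have := hT.apply_eigenvectorBasis rfl i
    rw [LinearMap.comp_apply] at this
    rw [hb, this, inner_smul_left]
    simp [hμ]
  have hbn : ∀ i, ‖b i‖ = 1 := fun i => b.norm_eq_one i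
  have hμn : ∀ i, μ i = ‖A (b i)‖ ^ 2 := by
    intro i
    rw [← real_inner_self_eq_norm_sq, hTb, real_inner_self_eq_norm_sq, hbn]; ring
  have hμt : ∀ i, |μ i - 1| ≤ t := by
    intro i
    have := hA (b i)
    rwa [← hμn, hbn, one_pow, mul_one] at this
  have hμ0 : ∀ i, 0 < μ i := fun i => by have := abs_le.1 (hμt i); linarith
  have hs0 : ∀ i, 0 < √(μ i) := fun i => Real.sqrt_pos.2 (hμ0 i)
  have hss : ∀ i, √(μ i) * √(μ i) = μ i := fun i => Real.mul_self_sqrt (hμ0 i).le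
  set g : Fin (Module.finrank ℝ E) → E := fun i => (√(μ i))⁻¹ • A (b i) with hg
  have hgA : ∀ i x, ⟪g i, A x⟫ = √(μ i) * ⟪b i, x⟫ := by
    intro i x
    rw [hg, inner_smul_left, hTb]
    simp only [conj_trivial]
    have := hs0 i
    field_simp
    rw [sq, hss]
  have hon : Orthonormal ℝ g := by
    rw [orthonormal_iff_ite]
    intro i j
    have : ⟪g i, g j⟫ = (√(μ j))⁻¹ * (√(μ i) * ⟪b i, b j⟫) := by
      rw [← hgA]; simp only [hg, inner_smul_right]
    rw [this, b.inner_eq_ite]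
    split_ifs with h
    · subst h; rw [mul_one, inv_mul_cancel₀ (hs0 i).ne']
    · simp
  have hsp : ⊤ ≤ Submodule.span ℝ (range g) := by
    rcases Nat.eq_zero_or_pos (Module.finrank ℝ E) with h | h
    · have := Module.finrank_zero_iff.1 h
      intro x _
      rw [Subsingleton.elim x 0]
      exact Submodule.zero_mem _
    · have : Nonempty (Fin (Module.finrank ℝ E)) := ⟨⟨0, h⟩⟩
      exact (hon.linearIndependent.span_eq_top_of_card_eq_finrank' (by simp)).ge
  set G := OrthonormalBasis.mk hon hsp with hG
  have hGg : ∀ i, G i = g i := fun i => by simp [hG]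
  refine ⟨b.equiv G (Equiv.refl _), fun x => ?_⟩
  have hQ : ∀ i, ⟪G i, (b.equiv G (Equiv.refl _)) x⟫ = ⟪b i, x⟫ := by
    intro i
    have : G i = (b.equiv G (Equiv.refl _)) (b i) := by simp
    rw [this, LinearIsometryEquiv.inner_map_map]
  have hsq : ‖A x - (b.equiv G (Equiv.refl _)) x‖ ^ 2 ≤ (t * ‖x‖) ^ 2 := by
    rw [← G.sum_sq_inner_right, mul_pow, ← b.sum_sq_inner_right x, Finset.mul_sum]
    refine Finset.sum_le_sum fun i _ => ?_
    rw [inner_sub_right, hQ, hGg, hgA, show √(μ i) * ⟪b i, x⟫ - ⟪b i, x⟫ = (√(μ i) - 1) * ⟪b i, x⟫ by ring, mul_pow]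
    refine mul_le_mul_of_nonneg_right ?_ (sq_nonneg _)
    rw [← sq_abs]
    refine pow_le_pow_left₀ (abs_nonneg _) ?_ 2
    refine le_trans ?_ (hμt i)
    rw [show μ i - 1 = (√(μ i) - 1) * (√(μ i) + 1) by linear_combination -(hss i), abs_mul]
    have h1 : 1 ≤ |√(μ i) + 1| := by
      have := hs0 i
      rw [abs_of_pos (by linarith)]; linarith
    exact le_mul_of_one_le_right (abs_nonneg _) h1
  exact (pow_le_pow_iff_left₀ (norm_nonneg _) (by positivity) (by norm_num)).1 hsq

lemma rounding {w v : κ → E} (hw1 : ∀ i, ‖w i‖ = 1)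
    (hw2 : ∀ i j, i ≠ j → ⟪w i, w j⟫ = -1 / (Module.finrank ℝ E : ℝ))
    (hcard : Fintype.card κ = Module.finrank ℝ E + 1) (hn : 0 < Module.finrank ℝ E)
    (hv1 : ∀ i, ‖v i‖ = 1) {d : ℝ} (hd0 : 0 ≤ d) (hd : Module.finrank ℝ E * d < 1)
    (hv2 : ∀ i j, i ≠ j → |⟪v i, v j⟫ + 1 / (Module.finrank ℝ E : ℝ)| ≤ d) :
    ∃ Q : E ≃ₗᵢ[ℝ] E, ∀ j, ‖v j - Q (w j)‖ ≤ Module.finrank ℝ E * d + √d := by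
  classical
  have hn' : (0:ℝ) < Module.finrank ℝ E := by exact_mod_cast hn
  have hfr := reg_frame hw1 hw2 hcard hn
  have hce := reg_cent hw1 hw2 hcard hn
  set n : ℝ := (Module.finrank ℝ E : ℝ) with hndef
  have hcard' : (Fintype.card κ : ℝ) = n + 1 := by rw [hcard]; push_cast; rfl
  set A : E →ₗ[ℝ] E := ∑ i, (n / (n + 1)) • ((innerSL ℝ (w i)).toLinearMap.smulRight (v i)) with hA
  have hAx : ∀ x, A x = ∑ i, (n / (n + 1) * ⟪w i, x⟫) • v i := by
    intro x
    simp [hA, smul_smul]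
  have hdiff : ∀ i j, |⟪v i, v j⟫ - ⟪w i, w j⟫| ≤ d := by
    intro i j
    by_cases h : i = j
    · subst h; rw [real_inner_self_eq_norm_sq, real_inner_self_eq_norm_sq, hv1, hw1]; simpa using hd0
    · rw [hw2 i j h]
      have := hv2 i j h
      rwa [neg_div, sub_neg_eq_add]
  have hAn : ∀ x, |‖A x‖ ^ 2 - ‖x‖ ^ 2| ≤ (n * d) * ‖x‖ ^ 2 := by
    intro x
    have e1 : ‖A x‖ ^ 2 = ∑ i, ∑ j, (n / (n + 1) * ⟪w i, x⟫) * (n / (n + 1) * ⟪w j, x⟫) * ⟪v i, v j⟫ := by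
      rw [← real_inner_self_eq_norm_sq, hAx, sum_inner]
      refine Finset.sum_congr rfl fun i _ => ?_
      rw [inner_sum]
      refine Finset.sum_congr rfl fun j _ => ?_
      rw [inner_smul_left, inner_smul_right]; simp only [conj_trivial]; ring
    have e2 : ‖x‖ ^ 2 = ∑ i, ∑ j, (n / (n + 1) * ⟪w i, x⟫) * (n / (n + 1) * ⟪w j, x⟫) * ⟪w i, w j⟫ := by
      have hx := frame_sum hfr x
      conv_lhs => rw [← real_inner_self_eq_norm_sq, ← hx, sum_inner]
      refine Finset.sum_congr rfl fun i _ => ?_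
      rw [inner_sum]
      refine Finset.sum_congr rfl fun j _ => ?_
      rw [inner_smul_left, inner_smul_right]; simp only [conj_trivial]; ring
    rw [e1, e2, ← Finset.sum_sub_distrib, ← e2]
    simp only [← Finset.sum_sub_distrib, ← mul_sub]
    calc _ ≤ ∑ i, ∑ j, (n / (n + 1) * |⟪w i, x⟫|) * (n / (n + 1) * |⟪w j, x⟫|) * d := by
          refine (Finset.abs_sum_le_sum_abs _ _).trans (Finset.sum_le_sum fun i _ => ?_)
          refine (Finset.abs_sum_le_sum_abs _ _).trans (Finset.sum_le_sum fun j _ => ?_)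
          rw [abs_mul, abs_mul, abs_mul, abs_mul, abs_of_pos (show 0 < n / (n + 1) by positivity)]
          exact mul_le_mul_of_nonneg_left (hdiff i j) (by positivity)
      _ = d * (n / (n + 1)) ^ 2 * (∑ i, |⟪w i, x⟫|) ^ 2 := by
          rw [sq (∑ i, |⟪w i, x⟫|), Finset.sum_mul_sum, Finset.mul_sum]
          refine Finset.sum_congr rfl fun i _ => ?_
          rw [Finset.mul_sum]
          refine Finset.sum_congr rfl fun j _ => ?_
          ring
      _ ≤ d * (n / (n + 1)) ^ 2 * ((n + 1) * ∑ i, ⟪w i, x⟫ ^ 2) := by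
          refine mul_le_mul_of_nonneg_left ?_ (by positivity)
          have := sq_sum_le_card_mul_sum_sq (s := Finset.univ) (f := fun i => |⟪w i, x⟫|)
          rw [Finset.card_univ, hcard'] at this
          simpa only [sq_abs] using this
      _ = _ := by
          rw [hfr x, ← Finset.mul_sum]
          field_simp
  obtain ⟨Q, hQ⟩ := near_iso A (t := n * d) (by positivity) hd hAn
  refine ⟨Q, fun j => ?_⟩
  set σ := ∑ i, v i with hσ
  have hAw : A (w j) = v j - (1 / (n + 1)) • σ := by
    rw [hAx, hσ, Finset.smul_sum, ← Finset.add_sum_erase _ _ (Finset.mem_univ j),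
      ← Finset.add_sum_erase Finset.univ (fun i => (1 / (n + 1)) • v i) (Finset.mem_univ j),
      real_inner_self_eq_norm_sq, hw1, ← sub_sub, sub_eq_add_neg, ← Finset.sum_neg_distrib]
    congr 1
    · rw [← one_smul ℝ (v j), smul_smul, smul_smul, ← sub_smul]
      congr 1
      field_simp
      ring
    · refine Finset.sum_congr rfl fun i hi => ?_
      rw [hw2 i j (Finset.ne_of_mem_erase hi), ← neg_smul]
      congr 1
      field_simp
  have hσn : ‖σ‖ ^ 2 ≤ ((n + 1) * √d) ^ 2 := by
    have e1 : ‖σ‖ ^ 2 = ∑ i, ∑ j, (⟪v i, v j⟫ - ⟪w i, w j⟫) := by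
      have h0 : ∑ i, ∑ j, ⟪w i, w j⟫ = 0 := by
        simp only [← inner_sum, hce]; simp
      simp only [Finset.sum_sub_distrib, h0, sub_zero]
      rw [← real_inner_self_eq_norm_sq, hσ, sum_inner]
      simp only [inner_sum]
    rw [e1, mul_pow, Real.sq_sqrt hd0]
    calc _ ≤ ∑ i : κ, ∑ j : κ, d := Finset.sum_le_sum fun i _ => Finset.sum_le_sum fun j _ =>
            (le_abs_self _).trans (hdiff i j)
      _ = _ := by simp [hcard']; ring
  have hσn' : ‖σ‖ ≤ (n + 1) * √d :=
    (pow_le_pow_iff_left₀ (norm_nonneg _) (by positivity) (by norm_num)).1 hσn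
  have e : v j - Q (w j) = (A (w j) - Q (w j)) + (1 / (n + 1)) • σ := by rw [hAw]; abel
  rw [e]
  refine (norm_add_le _ _).trans (add_le_add ?_ ?_)
  · have := hQ (w j)
    rwa [hw1, mul_one] at this
  · rw [norm_smul, Real.norm_eq_abs, abs_of_pos (by positivity), one_div, inv_mul_le_iff₀ (by positivity)]
    exact hσn'

lemma angle_le_of_dist {x y : E} (hx : ‖x‖ = 1) (hy : ‖y‖ = 1) :
    InnerProductGeometry.angle x y ≤ Real.pi / 2 * ‖x - y‖ := by
  set a := InnerProductGeometry.angle x y with ha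
  have h0 : 0 ≤ a := InnerProductGeometry.angle_nonneg x y
  have h1 : a ≤ Real.pi := InnerProductGeometry.angle_le_pi x y
  have hs := Real.mul_le_sin (x := a / 2) (by linarith) (by linarith)
  have hc : Real.cos a = ⟪x, y⟫ := by
    rw [ha, InnerProductGeometry.cos_angle, hx, hy]; simp
  have hn : ‖x - y‖ ^ 2 = (2 * Real.sin (a / 2)) ^ 2 := by
    rw [norm_sub_sq_real, hx, hy, ← hc, mul_pow, Real.sin_sq_eq_half_sub]
    rw [show 2 * (a / 2) = a by ring]; ring
  have hs0 : 0 ≤ Real.sin (a / 2) := Real.sin_nonneg_of_nonneg_of_le_pi (by linarith) (by linarith)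
  have hn' : ‖x - y‖ = 2 * Real.sin (a / 2) :=
    (pow_left_inj₀ (norm_nonneg _) (by positivity) (by norm_num)).1 hn
  rw [hn']
  have hp := Real.pi_pos
  calc a = Real.pi / 2 * (2 * (2 / Real.pi * (a / 2))) := by field_simp
    _ ≤ _ := by gcongr

end Round

theorem almost_regular_simplex_of_ell_large
    (n k : ℕ) (hn : 1 ≤ n) (hk₁ : n + 1 ≤ k) (hk₂ : k ≤ 2 * n ^ 2)
    (u : Fin k → EuclideanSpace ℝ (Fin n)) (hu : ∀ i, ‖u i‖ = 1)
    (c : Fin k → ℝ) (hc : ∀ i, 0 < c i)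
    (hiso : ∀ x : EuclideanSpace ℝ (Fin n), ‖x‖ ^ 2 = ∑ i, c i * ⟪u i, x⟫ ^ 2)
    (hcent : ∑ i, c i • u i = 0)
    (w₀ : Fin (n + 1) → EuclideanSpace ℝ (Fin n)) (hw₀ : IsRegVerts w₀)
    (ε : ℝ) (hε0 : 0 < ε) (hε1 : ε < ((n : ℝ) ^ (60 * n))⁻¹)
    (hℓ : (1 - ε) * ellNorm n (convexHull ℝ (Set.range w₀)) ≤
      ellNorm n (convexHull ℝ (Set.range u))) :
    (0 < (n : ℝ) ^ (15 * n) * ε ^ ((1 : ℝ) / 4) ∧ (n : ℝ) ^ (15 * n) * ε ^ ((1 : ℝ) / 4) < 1) ∧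
    ∃ w : Fin (n + 1) → EuclideanSpace ℝ (Fin n), IsRegVerts w ∧
      ∃ idx : Fin (n + 1) → Fin k, Function.Injective idx ∧
        ∀ j, InnerProductGeometry.angle (u (idx j)) (w j) ≤
          (n : ℝ) ^ (15 * n) * ε ^ ((1 : ℝ) / 4) := by
  have hn0 : (0:ℝ) < n := by exact_mod_cast hn
  set η : ℝ := (n : ℝ) ^ (15 * n) * ε ^ ((1 : ℝ) / 4) with hη
  have hη0 : 0 < η := by positivity
  have hη4 : η ^ 4 = (n : ℝ) ^ (60 * n) * ε := by
    rw [hη, mul_pow, ← pow_mul, ← Real.rpow_natCast (ε ^ ((1 : ℝ) / 4)), ← Real.rpow_mul hε0.le]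
    norm_num
    left; congr 1; ring
  have hη1 : η < 1 := by
    have h4 : η ^ 4 < 1 := by
      rw [hη4]
      have hp : (0:ℝ) < (n : ℝ) ^ (60 * n) := by positivity
      calc _ < (n : ℝ) ^ (60 * n) * ((n : ℝ) ^ (60 * n))⁻¹ := by gcongr
        _ = 1 := mul_inv_cancel₀ hp.ne'
    exact (pow_lt_one_iff_of_nonneg hη0.le (by norm_num)).1 h4
  refine ⟨⟨hη0, hη1⟩, ?_⟩
  rcases Nat.lt_or_ge n 2 with hn1 | hn2
  · have hn1' : n = 1 := by omega
    have hk : k = 2 := by subst hn1'; omega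
    subst hk
    subst hn1'
    refine ⟨u, ⟨hu, ?_⟩, id, fun a b h => h, fun j => ?_⟩
    · have h0 := congrArg (fun x => ⟪u 0, x⟫) hcent
      have h1 := congrArg (fun x => ⟪u 1, x⟫) hcent
      simp only [Fin.sum_univ_two, inner_add_right, inner_smul_right, real_inner_self_eq_norm_sq, hu,
        inner_zero_right, real_inner_comm (u 0) (u 1)] at h0 h1
      have c0 := hc 0
      have c1 := hc 1
      have key : ⟪u 0, u 1⟫ = -1 := by
        have hc01 : c 0 = c 1 := by
          have : (c 0 - c 1) * (c 0 + c 1) = 0 := by linear_combination c 0 * h0 - c 1 * h1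
          rcases mul_eq_zero.1 this with h | h <;> linarith
        rw [hc01] at h0
        have : c 1 * (1 + ⟪u 0, u 1⟫) = 0 := by linear_combination h0
        rcases mul_eq_zero.1 this with h | h <;> linarith
      have key' : ⟪u 1, u 0⟫ = -1 := by rw [real_inner_comm]; exact key
      intro i j hij
      change Fin 2 at i j
      fin_cases i <;> fin_cases j <;> simp_all
    · have : u j ≠ 0 := by
        intro h
        have := hu j
        rw [h] at this
        simp at this
      simp only [id]
      rw [InnerProductGeometry.angle_self this]
      exact hη0.le
  · have hn2' : (2:ℝ) ≤ n := by exact_mod_cast hn2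
    have hfin : Module.finrank ℝ (EuclideanSpace ℝ (Fin n)) = n := finrank_euclideanSpace_fin
    have hpos : 0 < Module.finrank ℝ (EuclideanSpace ℝ (Fin n)) := by rw [hfin]; omega
    have hC : ∀ i, 0 < ((Module.finrank ℝ (EuclideanSpace ℝ (Fin n)) : ℝ) + 1) /
        Module.finrank ℝ (EuclideanSpace ℝ (Fin n)) * c i := fun i => by
      have := hc i
      rw [hfin]
      positivity
    obtain ⟨idx, hidx1, hidx2⟩ := greedy (liftV_norm hu) hC (lift_frame hu hiso hcent hpos)
      (K := 2 * (n:ℝ) ^ 2) (by positivity) (by exact_mod_cast hk₂) (n + 1)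
      (by rw [lift_finrank, hfin])
    rw [hfin] at hidx1
    have hK0 : (0:ℝ) < 1 / (2 * (n:ℝ) ^ 2) := by positivity
    have hinj : Function.Injective idx := by
      intro a b hab
      by_contra hne
      have := hidx2 a b hne
      rw [hab, real_inner_self_eq_norm_sq, liftV_norm hu] at this
      linarith
    set d : ℝ := 3 / 2 * (η ^ 2 / (n:ℝ) ^ (5 * n)) with hd
    have hd0 : 0 ≤ d := by positivity
    have hpow : (n:ℝ) * 512 ≤ (n:ℝ) ^ (5 * n) := by
      calc (n:ℝ) * 512 ≤ (n:ℝ) * (n:ℝ) ^ 9 := by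
            have : (2:ℝ) ^ 9 ≤ (n:ℝ) ^ 9 := pow_le_pow_left₀ (by norm_num) hn2' _
            gcongr; linarith
        _ = (n:ℝ) ^ 10 := by ring
        _ ≤ _ := pow_le_pow_right₀ (by linarith) (by omega)
    have hp5 : (0:ℝ) < (n:ℝ) ^ (5 * n) := by positivity
    have hnd : n * d ≤ 3 / 1024 * η ^ 2 := by
      rw [hd, show (n:ℝ) * (3 / 2 * (η ^ 2 / (n:ℝ) ^ (5 * n))) = (3 / 2 * η ^ 2) * (n / (n:ℝ) ^ (5 * n)) by ring]
      have : (n:ℝ) / (n:ℝ) ^ (5 * n) ≤ 1 / 512 := by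
        rw [div_le_iff₀ hp5]; linarith
      calc _ ≤ (3 / 2 * η ^ 2) * (1 / 512) := by gcongr
        _ = _ := by ring
    have hη2 : η ^ 2 ≤ η := by nlinarith
    have hsd : √d ≤ η / 16 := by
      apply Real.sqrt_le_iff.2
      refine ⟨by positivity, ?_⟩
      nlinarith
    have hv2 : ∀ i j, i ≠ j → |⟪u (idx i), u (idx j)⟫ +
        1 / (Module.finrank ℝ (EuclideanSpace ℝ (Fin n)) : ℝ)| ≤ d := by
      intro i j hij
      have h := rho_bound n k hn2 u hu c hc hiso hcent w₀ hw₀ ε hε0 hℓ (hinj.ne hij) (hidx1 i) (hidx1 j)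
        (hidx2 i j hij)
      rw [hfin]
      have e : ⟪liftV u (idx i), liftV u (idx j)⟫ = n / (n + 1) * (⟪u (idx i), u (idx j)⟫ + 1 / n) := by
        rw [liftV_inner_liftV, hfin]
        field_simp
      rw [e] at h
      have h2 : (n:ℝ) ^ (50 * n) * ε = (η ^ 2 / (n:ℝ) ^ (5 * n)) ^ 2 := by
        rw [div_pow, ← pow_mul, ← pow_mul, show 2 * 2 = 4 by norm_num, hη4, eq_div_iff (by positivity),
          mul_right_comm, ← pow_add]
        congr 2; ring
      rw [h2] at h
      have h3 := abs_le_of_sq_le_sq h (by positivity)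
      have h3' := h3
      rw [abs_mul, abs_of_pos (show (0:ℝ) < n / (n + 1) by positivity)] at h3'
      have h4 : (2:ℝ) / 3 ≤ n / (n + 1) := by
        rw [div_le_div_iff₀ (by norm_num) (by positivity)]; linarith
      have h5 : (2:ℝ) / 3 * |⟪u (idx i), u (idx j)⟫ + 1 / n| ≤ η ^ 2 / (n:ℝ) ^ (5 * n) :=
        (mul_le_mul_of_nonneg_right h4 (abs_nonneg _)).trans h3'
      rw [hd]
      linarith
    have hw2' : ∀ i j, i ≠ j → ⟪w₀ i, w₀ j⟫ = -1 / (Module.finrank ℝ (EuclideanSpace ℝ (Fin n)) : ℝ) := by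
      rw [hfin]; exact hw₀.2
    obtain ⟨Q, hQ⟩ := rounding (v := fun j => u (idx j)) hw₀.1 hw2' (by rw [hfin]; simp) hpos
      (fun j => hu (idx j)) hd0 (by rw [hfin]; nlinarith) hv2
    refine ⟨fun j => Q (w₀ j), ⟨fun i => ?_, fun i j hij => ?_⟩, idx, hinj, fun j => ?_⟩
    · rw [LinearIsometryEquiv.norm_map]; exact hw₀.1 i
    · rw [LinearIsometryEquiv.inner_map_map]; exact hw₀.2 i j hij
    · refine (angle_le_of_dist (hu _) (by rw [LinearIsometryEquiv.norm_map]; exact hw₀.1 j)).trans ?_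
      have h1 := hQ j
      rw [hfin] at h1
      have h2 : ‖u (idx j) - Q (w₀ j)‖ ≤ η / 8 := by
        refine h1.trans ?_
        linarith
      have hpi := Real.pi_lt_d2
      have hpi0 := Real.pi_pos
      calc _ ≤ Real.pi / 2 * (η / 8) := by gcongr
        _ ≤ 4 / 2 * (η / 8) := by gcongr; linarith
        _ ≤ η := by linarith

end
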